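/- arXiv:1803.11296 — 2 statements merged into one kernel-verified Lean document; each statement's English description precedes it below -/
import Mathlib

section
/- Let (X,d_ℓ,μ_ℓ) be the cable system of a connected, locally finite, simple graph with a complete length function ℓ, with Dirichlet energy D and capacities Cap as below. Suppose the condition (cap_≤) holds with constants C, M ≥ 1, i.e. Cap_{B(x,Mr)}(B(x,r)) ≤ C for all x ∈ X and r ≥ 1. Then there exists a constant C₁ > 0 such that for all x ∈ X, all r ≥ 1 and all R ≥ Mr, one has Cap_{B(x,R)}(B(x,r)) ≤ C₁ (log(R/r))^{−1}. -/
open MeasureTheory Set Metric Filter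
open scoped ENNReal NNReal

noncomputable section

variable {V : Type*} {X : Type*}

/-- A *distortion function*: a homeomorphism of `[0,∞)` onto itself. -/
def IsDistortion (η : ℝ → ℝ) : Prop :=
  StrictMonoOn η (Set.Ici 0) ∧ ContinuousOn η (Set.Ici 0) ∧ η 0 = 0 ∧
    Set.MapsTo η (Set.Ici 0) (Set.Ici 0) ∧ Set.SurjOn η (Set.Ici 0) (Set.Ici 0)

/-- Two distance functions on the same set are *quasisymmetric* if the identity map is an
`η`-quasisymmetry for some distortion function `η`. -/
def QSPair {A : Type*} (d₁ d₂ : A → A → ℝ) : Prop :=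
  ∃ η : ℝ → ℝ, IsDistortion η ∧
    ∀ x a b : A, x ≠ b → d₂ x a / d₂ x b ≤ η (d₁ x a / d₁ x b)

/-- A graph has polynomial growth with volume growth exponent `d`:
`C⁻¹ r^d ≤ |B_G(x,r)| ≤ C r^d` for all vertices `x` and all `r ≥ 1`. -/
def HasPolynomialGrowth (G : SimpleGraph V) (d : ℝ) : Prop :=
  ∃ C : ℝ, 1 < C ∧ ∀ (x : V) (r : ℝ), 1 ≤ r →
    C⁻¹ * r ^ d ≤ (Nat.card {y : V | (G.dist x y : ℝ) < r} : ℝ) ∧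
    (Nat.card {y : V | (G.dist x y : ℝ) < r} : ℝ) ≤ C * r ^ d

/-- `IsCableSystem G ℓ μ vtx em` says that the metric measure space `X` (with its ambient
metric `dist` and measure `μ`) is the cable system of the graph `G` with length function `ℓ`:
each edge `{u,v}` of `G` corresponds to an isometrically embedded arc
`em u v : [0, ℓ u v] → X` (an arclength parametrisation), the arcs glue at the vertices and
cover `X`, the metric is the induced (maximal) length metric, and on each edge `μ` equals
`ℓ(e)` times arclength measure. -/
structure IsCableSystem (G : SimpleGraph V) (ℓ : V → V → ℝ) [MetricSpace X]
    [MeasurableSpace X] (μ : Measure X) (vtx : V → X) (em : V → V → ℝ → X) : Prop where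
  len_pos : ∀ u v, G.Adj u v → 0 < ℓ u v
  len_symm : ∀ u v, ℓ u v = ℓ v u
  edge_start : ∀ u v, G.Adj u v → em u v 0 = vtx u
  edge_flip : ∀ u v, G.Adj u v → ∀ s, em u v s = em v u (ℓ u v - s)
  edge_lip : ∀ u v, G.Adj u v → ∀ s ∈ Icc 0 (ℓ u v), ∀ t ∈ Icc 0 (ℓ u v),
    dist (em u v s) (em u v t) ≤ |s - t|
  edge_inj : ∀ u v, G.Adj u v → InjOn (em u v) (Icc 0 (ℓ u v))
  cover : ∀ x : X, ∃ u v s, G.Adj u v ∧ s ∈ Icc 0 (ℓ u v) ∧ em u v s = x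
  interior_disjoint : ∀ u v u' v', G.Adj u v → G.Adj u' v' →
    ∀ s ∈ Ioo 0 (ℓ u v), ∀ s' ∈ Ioo 0 (ℓ u' v'), em u v s = em u' v' s' →
      (u = u' ∧ v = v' ∧ s = s') ∨ (u = v' ∧ v = u' ∧ s = ℓ u v - s')
  isBorel : BorelSpace X
  dist_maximal : ∀ d' : X → X → ℝ, (∀ x, d' x x = 0) → (∀ x y, d' x y = d' y x) →
    (∀ x y z, d' x z ≤ d' x y + d' y z) →
    (∀ u v, G.Adj u v → ∀ s ∈ Icc 0 (ℓ u v), ∀ t ∈ Icc 0 (ℓ u v),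
      d' (em u v s) (em u v t) ≤ |s - t|) →
    ∀ x y, d' x y ≤ dist x y
  measure_edge : ∀ u v, G.Adj u v → ∀ A : Set ℝ, MeasurableSet A → A ⊆ Icc 0 (ℓ u v) →
    μ (em u v '' A) = ENNReal.ofReal (ℓ u v) * volume A

/-- `HasGradMod G ℓ em f g` : `f` is absolutely continuous (continuous on `X` and absolutely
continuous along each edge) and `g` is (a version of) the length of its gradient `|∇_ℓ f|`,
i.e. `g ≥ 0` and on each edge `f` is the integral of a signed derivative `h` with `|h| = g`
along the edge a.e. -/
def HasGradMod [TopologicalSpace X] (G : SimpleGraph V) (ℓ : V → V → ℝ)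
    (em : V → V → ℝ → X) (f g : X → ℝ) : Prop :=
  Continuous f ∧ (∀ x, 0 ≤ g x) ∧
    ∀ u v, G.Adj u v → ∃ h : ℝ → ℝ, IntegrableOn h (Icc 0 (ℓ u v)) ∧
      (∀ᵐ t ∂(volume.restrict (Icc 0 (ℓ u v))), |h t| = g (em u v t)) ∧
      ∀ t ∈ Icc 0 (ℓ u v), f (em u v t) = f (em u v 0) + ∫ s in Ioc 0 t, h s

/-- `HasEdgeDeriv G ℓ em f h` : `f` is absolutely continuous with (signed) edgewise derivative
`h u v : [0, ℓ u v] → ℝ` with respect to arclength along the (oriented) edge `(u,v)`. -/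
def HasEdgeDeriv [TopologicalSpace X] (G : SimpleGraph V) (ℓ : V → V → ℝ)
    (em : V → V → ℝ → X) (f : X → ℝ) (h : V → V → ℝ → ℝ) : Prop :=
  Continuous f ∧ ∀ u v, G.Adj u v → IntegrableOn (h u v) (Icc 0 (ℓ u v)) ∧
    ∀ t ∈ Icc 0 (ℓ u v), f (em u v t) = f (em u v 0) + ∫ s in Ioc 0 t, h u v s

/-- The Dirichlet energy `D(f,f) = ∫_X |∇_ℓ f|² dμ_ℓ` of an absolutely continuous function
(equal to `⊤` if `f` is not absolutely continuous). -/
def dirEnergy [TopologicalSpace X] [MeasurableSpace X] (G : SimpleGraph V)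
    (ℓ : V → V → ℝ) (em : V → V → ℝ → X) (μ : Measure X) (f : X → ℝ) : ℝ≥0∞ :=
  ⨅ (g : X → ℝ) (_ : HasGradMod G ℓ em f g), ∫⁻ x, ENNReal.ofReal (g x ^ 2) ∂μ

/-- `f` belongs to `F_D`: the closure, in the norm `(D(·,·) + ‖·‖²_{L²(μ)})^{1/2}`, of the
set of absolutely continuous, finite-energy functions with compact support contained in
`Dom`. -/
def MemFD [TopologicalSpace X] [MeasurableSpace X] (G : SimpleGraph V) (ℓ : V → V → ℝ)
    (em : V → V → ℝ → X) (μ : Measure X) (Dom : Set X) (f : X → ℝ) : Prop :=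
  ∃ F : ℕ → X → ℝ,
    (∀ n, (∃ g, HasGradMod G ℓ em (F n) g) ∧ HasCompactSupport (F n) ∧
      tsupport (F n) ⊆ Dom ∧ dirEnergy G ℓ em μ (F n) < ⊤) ∧
    Tendsto (fun n => dirEnergy G ℓ em μ (fun x => F n x - f x)
      + ∫⁻ x, ENNReal.ofReal ((F n x - f x) ^ 2) ∂μ) atTop (nhds 0)

/-- The capacity `Cap_D(A)`: the infimum of the Dirichlet energy over all `f ∈ F_D` with
`f ≥ 1` on a neighbourhood of `A`. -/
def capacity [TopologicalSpace X] [MeasurableSpace X] (G : SimpleGraph V) (ℓ : V → V → ℝ)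
    (em : V → V → ℝ → X) (μ : Measure X) (Dom A : Set X) : ℝ≥0∞ :=
  ⨅ (f : X → ℝ) (_ : MemFD G ℓ em μ Dom f ∧
      ∃ U : Set X, IsOpen U ∧ A ⊆ U ∧ ∀ x ∈ U, 1 ≤ f x),
    dirEnergy G ℓ em μ f

/-- The capacity upper bound `(cap_≤)`: there exist `C, M ≥ 1` with
`Cap_{B(x,Mr)}(B(x,r)) ≤ C` for all `x ∈ X` and `r ≥ 1`. -/
def CapLE [MetricSpace X] [MeasurableSpace X] (G : SimpleGraph V) (ℓ : V → V → ℝ)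
    (em : V → V → ℝ → X) (μ : Measure X) : Prop :=
  ∃ C M : ℝ, 1 ≤ C ∧ 1 ≤ M ∧ ∀ (x : X) (r : ℝ), 1 ≤ r →
    capacity G ℓ em μ (ball x (M * r)) (ball x r) ≤ ENNReal.ofReal C

/-- A curve in `X`: the data of an interval `[a,b]` and a map `ℝ → X` (to be continuous
on `[a,b]`). -/
abbrev CurveData (X : Type*) : Type _ := ℝ × ℝ × (ℝ → X)

/-- `g : [0,L] → X` is a `1`-Lipschitz parametrisation of the curve `c` on `[c.1, c.2.1]`
(such a parametrisation exists iff `c` is rectifiable, and the infimum of `∫_0^L ρ∘g` over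
all such parametrisations is the arclength line integral `∫_c ρ ds`). -/
def IsLipParamOf [PseudoMetricSpace X] (g : ℝ → X) (L : ℝ) (c : CurveData X) : Prop :=
  0 ≤ L ∧ LipschitzOnWith 1 g (Icc 0 L) ∧
    ∃ φ : ℝ → ℝ, MonotoneOn φ (Icc c.1 c.2.1) ∧ φ '' Icc c.1 c.2.1 = Icc 0 L ∧
      ∀ t ∈ Icc c.1 c.2.1, g (φ t) = c.2.2 t

/-- `ρ` is admissible for the curve family `Γ`: every (locally) rectifiable curve of `Γ` has
arclength line integral `∫_γ ρ ds ≥ 1`; equivalently `∫_{[0,L]} ρ ∘ g ≥ 1` for every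
`1`-Lipschitz parametrisation `g : [0,L] → X` of a curve of `Γ`. -/
def ModAdmissible [PseudoMetricSpace X] (Γ : Set (CurveData X)) (ρ : X → ℝ≥0∞) : Prop :=
  ∀ c ∈ Γ, ∀ (g : ℝ → X) (L : ℝ), IsLipParamOf g L c → 1 ≤ ∫⁻ t in Icc 0 L, ρ (g t)

/-- The `2`-modulus of a curve family. -/
def modulus [PseudoMetricSpace X] [MeasurableSpace X] (μ : Measure X)
    (Γ : Set (CurveData X)) : ℝ≥0∞ :=
  ⨅ (ρ : X → ℝ≥0∞) (_ : Measurable ρ ∧ ModAdmissible Γ ρ), ∫⁻ x, ρ x ^ 2 ∂μ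

/-- The family of curves joining `E` and `F`. -/
def JoiningCurves [TopologicalSpace X] (E F : Set X) : Set (CurveData X) :=
  {c | c.1 ≤ c.2.1 ∧ ContinuousOn c.2.2 (Icc c.1 c.2.1) ∧ c.2.2 c.1 ∈ E ∧ c.2.2 c.2.1 ∈ F}

/-- Distance between two sets. -/
def setDist [PseudoMetricSpace X] (E F : Set X) : ℝ :=
  sInf ((fun q : X × X => dist q.1 q.2) '' E ×ˢ F)

/-- The Poincaré inequality `PI(Ψ)` for the cable system. -/
def PoincareIneq [MetricSpace X] [MeasurableSpace X] (G : SimpleGraph V) (ℓ : V → V → ℝ)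
    (em : V → V → ℝ → X) (μ : Measure X) (Ψ : ℝ → ℝ) : Prop :=
  ∃ C M : ℝ, 1 ≤ C ∧ 1 ≤ M ∧
    ∀ f g : X → ℝ, HasGradMod G ℓ em f g → (∫⁻ x, ENNReal.ofReal (g x ^ 2) ∂μ) < ⊤ →
      ∀ (x : X) (r : ℝ), 0 < r → ENNReal.ofReal (2 * r) < EMetric.diam (univ : Set X) →
        ∫⁻ y in ball x r, ENNReal.ofReal ((f y - ⨍ z in ball x r, f z ∂μ) ^ 2) ∂μ ≤
          ENNReal.ofReal (C * Ψ r) * ∫⁻ y in ball x (M * r), ENNReal.ofReal (g y ^ 2) ∂μ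

/-- Annular quasi-convexity at large scales. -/
def AnnularQCLargeScales (X : Type*) [PseudoMetricSpace X] : Prop :=
  ∃ R C : ℝ, 0 < R ∧ 0 < C ∧ ∀ (x : X) (r : ℝ), R ≤ r →
    ∀ y ∈ ball x (2 * r) \ ball x r, ∀ z ∈ ball x (2 * r) \ ball x r,
      ∃ (a b : ℝ) (γ : ℝ → X), a ≤ b ∧ ContinuousOn γ (Icc a b) ∧ γ a = y ∧ γ b = z ∧
        ∀ t ∈ Icc a b, γ t ∈ ball x (C * r) \ ball x (r / C)



section CableCalculus

theorem AbsolutelyContinuousOnInterval.congr_on {f g : ℝ → ℝ} {a b : ℝ}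
    (hf : AbsolutelyContinuousOnInterval f a b) (h : EqOn f g (uIcc a b)) :
    AbsolutelyContinuousOnInterval g a b := by
  rw [absolutelyContinuousOnInterval_iff] at hf ⊢
  intro ε hε
  obtain ⟨δ, hδ, H⟩ := hf ε hε
  refine ⟨δ, hδ, fun E hE hlt => ?_⟩
  refine lt_of_eq_of_lt (Finset.sum_congr rfl fun i hi => ?_) (H E hE hlt)
  have := hE.1 i hi
  rw [h this.1, h this.2]

theorem AbsolutelyContinuousOnInterval.lipschitz_comp {f T : ℝ → ℝ} {a b : ℝ} {K : ℝ≥0}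
    (hT : LipschitzWith K T) (hf : AbsolutelyContinuousOnInterval f a b) :
    AbsolutelyContinuousOnInterval (fun s => T (f s)) a b := by
  unfold AbsolutelyContinuousOnInterval at hf ⊢
  refine squeeze_zero (fun _ => Finset.sum_nonneg fun _ _ => dist_nonneg)
    (fun E => ?_) (by simpa using hf.const_mul (K : ℝ))
  rw [Finset.mul_sum]
  exact Finset.sum_le_sum fun i _ => hT.dist_le_mul _ _

/-- `f` is continuous on `X` and absolutely continuous along each edge. -/
def EdgeAC [TopologicalSpace X] (G : SimpleGraph V) (ℓ : V → V → ℝ) (em : V → V → ℝ → X)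
    (f : X → ℝ) : Prop :=
  Continuous f ∧ ∀ u v, G.Adj u v →
    AbsolutelyContinuousOnInterval (fun s => f (em u v s)) 0 (ℓ u v)

open Classical in
/-- The modulus of the arclength derivative of `f`, as a function on `X`. -/
def gradMod (G : SimpleGraph V) (ℓ : V → V → ℝ) (em : V → V → ℝ → X) (f : X → ℝ) (y : X) : ℝ :=
  if h : ∃ p : V × V × ℝ, G.Adj p.1 p.2.1 ∧ p.2.2 ∈ Ioo 0 (ℓ p.1 p.2.1) ∧
      em p.1 p.2.1 p.2.2 = y then
    |deriv (fun s => f (em h.choose.1 h.choose.2.1 s)) h.choose.2.2|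
  else 0

/-- The squared norm `D(f,f) + ‖f‖²`. -/
def normSq [TopologicalSpace X] [MeasurableSpace X] (G : SimpleGraph V)
    (ℓ : V → V → ℝ) (em : V → V → ℝ → X) (μ : Measure X) (f : X → ℝ) : ℝ≥0∞ :=
  dirEnergy G ℓ em μ f + ∫⁻ x, ENNReal.ofReal (f x ^ 2) ∂μ

variable {G : SimpleGraph V} {ℓ : V → V → ℝ} {em : V → V → ℝ → X}

theorem gradMod_nonneg (f : X → ℝ) (y : X) : 0 ≤ gradMod G ℓ em f y := by
  unfold gradMod
  split_ifs
  · exact abs_nonneg _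
  · exact le_rfl

theorem gradMod_zero (y : X) : gradMod G ℓ em (fun _ : X => (0 : ℝ)) y = 0 := by
  unfold gradMod
  split_ifs <;> simp

section Topological

variable [TopologicalSpace X]

theorem EdgeAC.add {f g : X → ℝ} (hf : EdgeAC G ℓ em f) (hg : EdgeAC G ℓ em g) :
    EdgeAC G ℓ em (fun x => f x + g x) :=
  ⟨hf.1.add hg.1, fun u v h => (hf.2 u v h).add (hg.2 u v h)⟩

theorem EdgeAC.sub {f g : X → ℝ} (hf : EdgeAC G ℓ em f) (hg : EdgeAC G ℓ em g) :
    EdgeAC G ℓ em (fun x => f x - g x) :=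
  ⟨hf.1.sub hg.1, fun u v h => (hf.2 u v h).sub (hg.2 u v h)⟩

theorem EdgeAC.const_mul {f : X → ℝ} (hf : EdgeAC G ℓ em f) (c : ℝ) :
    EdgeAC G ℓ em (fun x => c * f x) :=
  ⟨continuous_const.mul hf.1, fun u v h => (hf.2 u v h).const_mul c⟩

theorem EdgeAC.lipschitz_comp {f : X → ℝ} {T : ℝ → ℝ} {K : ℝ≥0} (hT : LipschitzWith K T)
    (hf : EdgeAC G ℓ em f) : EdgeAC G ℓ em (fun x => T (f x)) :=
  ⟨hT.continuous.comp hf.1, fun u v h => (hf.2 u v h).lipschitz_comp hT⟩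

theorem edgeAC_zero : EdgeAC G ℓ em (fun _ : X => (0 : ℝ)) := by
  refine ⟨continuous_const, fun u v _ => ?_⟩
  exact (LipschitzWith.const (0 : ℝ)).lipschitzOnWith.absolutelyContinuousOnInterval

end Topological

theorem SimpleGraph.Connected.countable_of_finite_neighborSet (hconn : G.Connected)
    (hlf : ∀ v : V, (G.neighborSet v).Finite) : Countable V := by
  obtain ⟨v₀⟩ := hconn.nonempty
  have hfin : ∀ n : ℕ, {v | ∃ p : G.Walk v v₀, p.length = n}.Finite := by
    intro n
    induction n with
    | zero =>
      refine (Set.finite_singleton v₀).subset ?_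
      rintro v ⟨p, hp⟩
      exact SimpleGraph.Walk.eq_of_length_eq_zero hp
    | succ n ih =>
      refine (ih.biUnion fun w _ => hlf w).subset ?_
      rintro v ⟨p, hp⟩
      cases p with
      | nil => simp at hp
      | cons h q =>
        simp only [SimpleGraph.Walk.length_cons, add_left_inj] at hp
        exact Set.mem_biUnion (show _ ∈ {v | ∃ p : G.Walk v v₀, p.length = n} from ⟨q, hp⟩) h.symm
  rw [← Set.countable_univ_iff]
  refine (Set.countable_iUnion fun n => (hfin n).countable).mono fun v _ => ?_
  obtain ⟨p⟩ := hconn.preconnected v v₀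
  exact Set.mem_iUnion.2 ⟨p.length, p, rfl⟩

theorem lintegral_sq_le_of_ae_le_add {α : Type*} [MeasurableSpace α] {μ : Measure α} {a b c : α → ℝ}
    (ha : ∀ᵐ x ∂μ, |a x| ≤ |b x| + |c x|)
    (hb : AEMeasurable b μ) :
    ∫⁻ x, ENNReal.ofReal (a x ^ 2) ∂μ ≤
      2 * ∫⁻ x, ENNReal.ofReal (b x ^ 2) ∂μ + 2 * ∫⁻ x, ENNReal.ofReal (c x ^ 2) ∂μ := by
  have hb' : AEMeasurable (fun x => ENNReal.ofReal (b x ^ 2)) μ := (hb.pow_const 2).ennreal_ofReal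
  rw [← lintegral_const_mul'' _ hb', ← lintegral_const_mul' _ _ (by simp),
    ← lintegral_add_left' (hb'.const_mul 2)]
  refine lintegral_mono_ae ?_
  filter_upwards [ha] with x hx
  rw [← ENNReal.ofReal_ofNat 2, ← ENNReal.ofReal_mul (by norm_num),
    ← ENNReal.ofReal_mul (by norm_num), ← ENNReal.ofReal_add (by positivity) (by positivity)]
  apply ENNReal.ofReal_le_ofReal
  have := pow_le_pow_left₀ (abs_nonneg (a x)) hx 2
  rw [sq_abs] at this
  nlinarith [sq_nonneg (|b x| - |c x|), sq_abs (b x), sq_abs (c x)]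

variable [MetricSpace X] [MeasurableSpace X] {μ : Measure X} {vtx : V → X}

namespace IsCableSystem

theorem gradMod_apply (hcs : IsCableSystem G ℓ μ vtx em) (f : X → ℝ) {u v : V} {t : ℝ}
    (huv : G.Adj u v) (ht : t ∈ Ioo 0 (ℓ u v)) :
    gradMod G ℓ em f (em u v t) = |deriv (fun s => f (em u v s)) t| := by
  have h : ∃ p : V × V × ℝ, G.Adj p.1 p.2.1 ∧ p.2.2 ∈ Ioo 0 (ℓ p.1 p.2.1) ∧
      em p.1 p.2.1 p.2.2 = em u v t := ⟨(u, v, t), huv, ht, rfl⟩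
  unfold gradMod
  rw [dif_pos h]
  obtain ⟨h1, h2, h3⟩ := h.choose_spec
  generalize h.choose = p at h1 h2 h3 ⊢
  obtain ⟨u', v', t'⟩ := p
  rcases hcs.interior_disjoint _ _ _ _ h1 huv _ h2 _ ht h3 with ⟨rfl, rfl, rfl⟩ | ⟨rfl, rfl, htt⟩
  · rfl
  · dsimp only at htt h1 h2 h3 ⊢
    have : (fun s => f (em u' v' s)) = fun s => (fun s => f (em v' u' s)) (ℓ u' v' - s) := by
      funext s
      simp only
      rw [hcs.edge_flip _ _ h1]
    rw [this, deriv_comp_const_sub (f := fun s => f (em v' u' s)), abs_neg, htt]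
    congr 2
    ring

theorem ae_of_edge (hcs : IsCableSystem G ℓ μ vtx em) [Countable V] {P : V → V → ℝ → Prop}
    (hP : ∀ u v, G.Adj u v → ∀ᵐ t, t ∈ Ioo 0 (ℓ u v) → P u v t) :
    ∀ᵐ y ∂μ, ∃ u v t, G.Adj u v ∧ t ∈ Ioo 0 (ℓ u v) ∧ em u v t = y ∧ P u v t := by
  have key : ∀ u v, G.Adj u v → μ (em u v ''
      {t | t ∈ Icc 0 (ℓ u v) ∧ ¬ (t ∈ Ioo 0 (ℓ u v) ∧ P u v t)}) = 0 := by
    intro u v huv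
    have hnull : volume {t | t ∈ Icc 0 (ℓ u v) ∧ ¬ (t ∈ Ioo 0 (ℓ u v) ∧ P u v t)} = 0 := by
      rw [← MeasureTheory.compl_mem_ae_iff]
      have h0 : ∀ᵐ t : ℝ, t ≠ 0 := by simp [ae_iff]
      have h1 : ∀ᵐ t : ℝ, t ≠ ℓ u v := by simp [ae_iff]
      filter_upwards [hP u v huv, h0, h1] with t ht ht0 ht1
      rintro ⟨hI, hn⟩
      have : t ∈ Ioo 0 (ℓ u v) := ⟨lt_of_le_of_ne hI.1 (Ne.symm ht0), lt_of_le_of_ne hI.2 ht1⟩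
      exact hn ⟨this, ht this⟩
    set N := {t | t ∈ Icc 0 (ℓ u v) ∧ ¬ (t ∈ Ioo 0 (ℓ u v) ∧ P u v t)}
    refine measure_mono_null (image_mono (t := toMeasurable volume N ∩ Icc 0 (ℓ u v))
      (subset_inter (subset_toMeasurable _ _) fun t ht => ht.1)) ?_
    rw [hcs.measure_edge u v huv _ ((measurableSet_toMeasurable _ _).inter measurableSet_Icc)
      inter_subset_right, measure_mono_null inter_subset_left (by rw [measure_toMeasurable, hnull]),
      mul_zero]
  have hall : μ (⋃ (u) (v) (_ : G.Adj u v), em u v ''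
      {t | t ∈ Icc 0 (ℓ u v) ∧ ¬ (t ∈ Ioo 0 (ℓ u v) ∧ P u v t)}) = 0 := by
    simp only [measure_iUnion_null_iff]
    exact key
  rw [ae_iff]
  refine measure_mono_null (fun y hy => ?_) hall
  obtain ⟨u, v, s, huv, hs, rfl⟩ := hcs.cover y
  simp only [mem_iUnion]
  refine ⟨u, v, huv, s, ⟨hs, fun h => hy ⟨u, v, s, huv, h.1, rfl, h.2⟩⟩, rfl⟩

theorem aemeasurable_gradMod (hcs : IsCableSystem G ℓ μ vtx em) [Countable V] (f : X → ℝ) :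
    AEMeasurable (gradMod G ℓ em f) μ := by
  have := hcs.isBorel
  have hcont : ∀ u v, G.Adj u v → ContinuousOn (em u v) (Ioo 0 (ℓ u v)) := by
    intro u v huv
    have : LipschitzOnWith 1 (em u v) (Icc 0 (ℓ u v)) :=
      LipschitzOnWith.of_dist_le_mul fun s hs t ht => by
        simpa [Real.dist_eq] using hcs.edge_lip u v huv s hs t ht
    exact this.continuousOn.mono Ioo_subset_Icc_self
  have hemb : ∀ u v, G.Adj u v →
      MeasurableEmbedding ((Ioo 0 (ℓ u v)).domRestrict (em u v)) := fun u v huv =>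
    (hcont u v huv).measurableEmbedding measurableSet_Ioo
      ((hcs.edge_inj u v huv).mono Ioo_subset_Icc_self)
  have hcover : μ.restrict (⋃ p : {p : V × V // G.Adj p.1 p.2},
      em p.1.1 p.1.2 '' Ioo 0 (ℓ p.1.1 p.1.2)) = μ := by
    rw [Measure.restrict_eq_self_of_ae_mem]
    filter_upwards [hcs.ae_of_edge (P := fun _ _ _ => True) (by simp)] with y hy
    obtain ⟨u, v, t, huv, ht, rfl, -⟩ := hy
    exact mem_iUnion.2 ⟨⟨(u, v), huv⟩, t, ht, rfl⟩
  rw [← hcover, aemeasurable_iUnion_iff]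
  rintro ⟨⟨u, v⟩, huv⟩
  have he := hemb u v huv
  have hrange : em u v '' Ioo 0 (ℓ u v) = range ((Ioo 0 (ℓ u v)).domRestrict (em u v)) :=
    (range_domRestrict _ _).symm
  have hk : Measurable fun t : Ioo 0 (ℓ u v) => |deriv (fun s => f (em u v s)) t| :=
    ((measurable_deriv _).comp measurable_subtype_coe).abs
  refine ⟨_, he.measurable_extend hk (measurable_const (a := (0 : ℝ))), ?_⟩
  dsimp only
  rw [hrange]
  refine (ae_restrict_iff' he.measurableSet_range).2 (Eventually.of_forall ?_)
  rintro _ ⟨t, rfl⟩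
  rw [he.injective.extend_apply]
  exact hcs.gradMod_apply f huv t.2

theorem hasGradMod_gradMod (hcs : IsCableSystem G ℓ μ vtx em) {f : X → ℝ}
    (hf : EdgeAC G ℓ em f) : HasGradMod G ℓ em f (gradMod G ℓ em f) := by
  refine ⟨hf.1, gradMod_nonneg f, fun u v huv => ?_⟩
  have hpos := (hcs.len_pos u v huv).le
  refine ⟨deriv fun s => f (em u v s), ?_, ?_, ?_⟩
  · have := (hf.2 u v huv).intervalIntegrable_deriv
    rwa [intervalIntegrable_iff_integrableOn_Icc_of_le hpos] at this
  · rw [← restrict_Ioo_eq_restrict_Icc]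
    filter_upwards [ae_restrict_mem measurableSet_Ioo] with t ht
    rw [hcs.gradMod_apply f huv ht]
  · intro t ht
    have hm : AbsolutelyContinuousOnInterval (fun s => f (em u v s)) 0 t :=
      (hf.2 u v huv).mono (by rw [uIcc_of_le ht.1, uIcc_of_le hpos]; exact Icc_subset_Icc_right ht.2)
    rw [← intervalIntegral.integral_of_le ht.1, hm.integral_deriv_eq_sub]
    ring

end IsCableSystem

theorem HasGradMod.edgeAC {f g : X → ℝ} (hcs : IsCableSystem G ℓ μ vtx em)
    (h : HasGradMod G ℓ em f g) : EdgeAC G ℓ em f := by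
  refine ⟨h.1, fun u v huv => ?_⟩
  obtain ⟨k, hk, -, hfk⟩ := h.2.2 u v huv
  have hpos := (hcs.len_pos u v huv).le
  have hk' : IntervalIntegrable k volume 0 (ℓ u v) := by
    rwa [intervalIntegrable_iff_integrableOn_Icc_of_le hpos]
  have h1 := hk'.absolutelyContinuousOnInterval_intervalIntegral (c := 0) (by simp)
  have h2 : AbsolutelyContinuousOnInterval (fun _ : ℝ => f (em u v 0)) 0 (ℓ u v) :=
    (LipschitzWith.const _).lipschitzOnWith.absolutelyContinuousOnInterval
  refine (h2.add h1).congr_on fun t ht => ?_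
  rw [uIcc_of_le hpos] at ht
  simp only [Pi.add_apply]
  rw [hfk t ht, intervalIntegral.integral_of_le ht.1]

theorem HasGradMod.ae_eq_gradMod {f g : X → ℝ} (hcs : IsCableSystem G ℓ μ vtx em) [Countable V]
    (h : HasGradMod G ℓ em f g) : g =ᵐ[μ] gradMod G ℓ em f := by
  have := hcs.ae_of_edge (P := fun u v t => |deriv (fun s => f (em u v s)) t| = g (em u v t)) ?_
  · filter_upwards [this] with y hy
    obtain ⟨u, v, t, huv, ht, rfl, hP⟩ := hy
    rw [hcs.gradMod_apply f huv ht, hP]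
  intro u v huv
  obtain ⟨k, hk, hkg, hfk⟩ := h.2.2 u v huv
  have hpos := (hcs.len_pos u v huv).le
  have hk' : IntervalIntegrable k volume 0 (ℓ u v) := by
    rwa [intervalIntegrable_iff_integrableOn_Icc_of_le hpos]
  rw [ae_restrict_iff' measurableSet_Icc] at hkg
  filter_upwards [hkg, hk'.ae_hasDerivAt_integral] with t h1 h2 ht
  have htI := Ioo_subset_Icc_self ht
  rw [← h1 htI]
  have h3 := (h2 (by rwa [uIcc_of_le hpos]) 0 (by simp)).const_add (f (em u v 0))
  have h4 : HasDerivAt (fun s => f (em u v s)) (k t) t := by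
    refine h3.congr_of_eventuallyEq ?_
    filter_upwards [Ioo_mem_nhds ht.1 ht.2] with s hs
    rw [hfk s (Ioo_subset_Icc_self hs), intervalIntegral.integral_of_le hs.1.le]
  rw [h4.deriv]

theorem EdgeAC.dirEnergy_eq {f : X → ℝ} (hcs : IsCableSystem G ℓ μ vtx em) [Countable V]
    (hf : EdgeAC G ℓ em f) :
    dirEnergy G ℓ em μ f = ∫⁻ x, ENNReal.ofReal (gradMod G ℓ em f x ^ 2) ∂μ := by
  refine le_antisymm (iInf₂_le _ (hcs.hasGradMod_gradMod hf)) (le_iInf₂ fun g hg => ?_)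
  refine (lintegral_congr_ae ?_).le
  filter_upwards [hg.ae_eq_gradMod hcs] with y hy
  rw [hy]

theorem edgeAC_of_dirEnergy_lt_top {f : X → ℝ} (hcs : IsCableSystem G ℓ μ vtx em)
    (h : dirEnergy G ℓ em μ f < ⊤) : EdgeAC G ℓ em f := by
  simp only [dirEnergy, iInf_lt_iff] at h
  obtain ⟨g, hg, -⟩ := h
  exact hg.edgeAC hcs

theorem EdgeAC.ae_differentiableAt {f : X → ℝ} (hcs : IsCableSystem G ℓ μ vtx em)
    (hf : EdgeAC G ℓ em f) {u v : V} (huv : G.Adj u v) :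
    ∀ᵐ t, t ∈ Ioo 0 (ℓ u v) → DifferentiableAt ℝ (fun s => f (em u v s)) t := by
  filter_upwards [(hf.2 u v huv).ae_differentiableAt] with t ht htI
  exact ht (by rw [uIcc_of_le (hcs.len_pos u v huv).le]; exact Ioo_subset_Icc_self htI)

theorem EdgeAC.ae_differentiableAt₂ {f g : X → ℝ} (hcs : IsCableSystem G ℓ μ vtx em) [Countable V]
    (hf : EdgeAC G ℓ em f) (hg : EdgeAC G ℓ em g) :
    ∀ᵐ y ∂μ, ∃ u v t, G.Adj u v ∧ t ∈ Ioo 0 (ℓ u v) ∧ em u v t = y ∧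
      DifferentiableAt ℝ (fun s => f (em u v s)) t ∧
      DifferentiableAt ℝ (fun s => g (em u v s)) t := by
  refine hcs.ae_of_edge fun u v huv => ?_
  filter_upwards [hf.ae_differentiableAt hcs huv, hg.ae_differentiableAt hcs huv] with t h1 h2 ht
  exact ⟨h1 ht, h2 ht⟩

theorem EdgeAC.gradMod_add_le {f g : X → ℝ} (hcs : IsCableSystem G ℓ μ vtx em) [Countable V]
    (hf : EdgeAC G ℓ em f) (hg : EdgeAC G ℓ em g) :
    ∀ᵐ y ∂μ, gradMod G ℓ em (fun x => f x + g x) y ≤ gradMod G ℓ em f y + gradMod G ℓ em g y := by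
  filter_upwards [hf.ae_differentiableAt₂ hcs hg] with y hy
  obtain ⟨u, v, t, huv, ht, rfl, h1, h2⟩ := hy
  rw [hcs.gradMod_apply _ huv ht, hcs.gradMod_apply _ huv ht, hcs.gradMod_apply _ huv ht,
    deriv_fun_add h1 h2]
  exact abs_add_le _ _

theorem EdgeAC.gradMod_const_mul {f : X → ℝ} (hcs : IsCableSystem G ℓ μ vtx em) [Countable V]
    (hf : EdgeAC G ℓ em f) (c : ℝ) :
    ∀ᵐ y ∂μ, gradMod G ℓ em (fun x => c * f x) y = |c| * gradMod G ℓ em f y := by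
  filter_upwards [hf.ae_differentiableAt₂ hcs hf] with y hy
  obtain ⟨u, v, t, huv, ht, rfl, h1, -⟩ := hy
  rw [hcs.gradMod_apply _ huv ht, hcs.gradMod_apply _ huv ht, deriv_const_mul _ h1, abs_mul]

theorem EdgeAC.gradMod_comp {f : X → ℝ} {T : ℝ → ℝ} (hcs : IsCableSystem G ℓ μ vtx em)
    [Countable V] (hf : EdgeAC G ℓ em f) (hT : Differentiable ℝ T) :
    ∀ᵐ y ∂μ, gradMod G ℓ em (fun x => T (f x)) y = |deriv T (f y)| * gradMod G ℓ em f y := by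
  filter_upwards [hf.ae_differentiableAt₂ hcs hf] with y hy
  obtain ⟨u, v, t, huv, ht, rfl, h1, -⟩ := hy
  have h2 : HasDerivAt (fun s => T (f (em u v s))) _ t :=
    (hT (f (em u v t))).hasDerivAt.comp t h1.hasDerivAt
  rw [hcs.gradMod_apply _ huv ht, hcs.gradMod_apply _ huv ht, h2.deriv, abs_mul]

theorem EdgeAC.gradMod_comp_sub_le {F f : X → ℝ} {T : ℝ → ℝ} {K : ℝ}
    (hcs : IsCableSystem G ℓ μ vtx em) [Countable V]
    (hF : EdgeAC G ℓ em F) (hf : EdgeAC G ℓ em f) (hT : Differentiable ℝ T)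
    (hK : ∀ s, |deriv T s| ≤ K) :
    ∀ᵐ y ∂μ, gradMod G ℓ em (fun x => T (F x) - T (f x)) y ≤
      K * gradMod G ℓ em (fun x => F x - f x) y +
        |deriv T (F y) - deriv T (f y)| * gradMod G ℓ em f y := by
  filter_upwards [hF.ae_differentiableAt₂ hcs hf] with y hy
  obtain ⟨u, v, t, huv, ht, rfl, h1, h2⟩ := hy
  have h3 : HasDerivAt (fun s => T (F (em u v s))) _ t :=
    (hT (F (em u v t))).hasDerivAt.comp t h1.hasDerivAt
  have h4 : HasDerivAt (fun s => T (f (em u v s))) _ t :=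
    (hT (f (em u v t))).hasDerivAt.comp t h2.hasDerivAt
  rw [hcs.gradMod_apply _ huv ht, hcs.gradMod_apply _ huv ht, hcs.gradMod_apply _ huv ht,
    (h3.fun_sub h4).deriv, deriv_fun_sub h1 h2]
  set a := deriv (fun s => F (em u v s)) t
  set b := deriv (fun s => f (em u v s)) t
  set p := deriv T (F (em u v t)) with hp
  set q := deriv T (f (em u v t))
  calc |p * a - q * b| = |p * (a - b) + (p - q) * b| := by ring_nf
    _ ≤ |p * (a - b)| + |(p - q) * b| := abs_add_le _ _
    _ = |p| * |a - b| + |p - q| * |b| := by rw [abs_mul, abs_mul]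
    _ ≤ K * |a - b| + |p - q| * |b| := by
      gcongr
      exact hK _

theorem EdgeAC.dirEnergy_add_le {f g : X → ℝ} (hcs : IsCableSystem G ℓ μ vtx em) [Countable V]
    (hf : EdgeAC G ℓ em f) (hg : EdgeAC G ℓ em g) :
    dirEnergy G ℓ em μ (fun x => f x + g x) ≤
      2 * dirEnergy G ℓ em μ f + 2 * dirEnergy G ℓ em μ g := by
  rw [hf.dirEnergy_eq hcs, hg.dirEnergy_eq hcs, (hf.add hg).dirEnergy_eq hcs]
  refine lintegral_sq_le_of_ae_le_add ?_ (hcs.aemeasurable_gradMod f)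
  filter_upwards [hf.gradMod_add_le hcs hg] with y hy
  simpa only [abs_of_nonneg (gradMod_nonneg _ _)] using hy

theorem EdgeAC.dirEnergy_const_mul {f : X → ℝ} (hcs : IsCableSystem G ℓ μ vtx em) [Countable V]
    (hf : EdgeAC G ℓ em f) (c : ℝ) :
    dirEnergy G ℓ em μ (fun x => c * f x) = ENNReal.ofReal (c ^ 2) * dirEnergy G ℓ em μ f := by
  rw [hf.dirEnergy_eq hcs, (hf.const_mul c).dirEnergy_eq hcs,
    ← lintegral_const_mul' _ _ ENNReal.ofReal_ne_top]
  refine lintegral_congr_ae ?_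
  filter_upwards [hf.gradMod_const_mul hcs c] with y hy
  rw [hy, mul_pow, sq_abs, ENNReal.ofReal_mul (sq_nonneg _)]

theorem EdgeAC.dirEnergy_comp_le {f : X → ℝ} {T : ℝ → ℝ} {K : ℝ≥0}
    (hcs : IsCableSystem G ℓ μ vtx em) [Countable V] (hf : EdgeAC G ℓ em f)
    (hT : Differentiable ℝ T) (hL : LipschitzWith K T) (hK : ∀ s, |deriv T s| ≤ K) :
    dirEnergy G ℓ em μ (fun x => T (f x)) ≤
      ENNReal.ofReal ((K : ℝ) ^ 2) * dirEnergy G ℓ em μ f := by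
  rw [hf.dirEnergy_eq hcs, (hf.lipschitz_comp hL).dirEnergy_eq hcs,
    ← lintegral_const_mul' _ _ ENNReal.ofReal_ne_top]
  refine lintegral_mono_ae ?_
  filter_upwards [hf.gradMod_comp hcs hT] with y hy
  rw [hy, ← ENNReal.ofReal_mul (sq_nonneg _), ← mul_pow]
  have := gradMod_nonneg (G := G) (ℓ := ℓ) (em := em) f y
  gcongr
  exact hK _

theorem EdgeAC.normSq_add_le {f g : X → ℝ} (hcs : IsCableSystem G ℓ μ vtx em) [Countable V]
    (hf : EdgeAC G ℓ em f) (hg : EdgeAC G ℓ em g) :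
    normSq G ℓ em μ (fun x => f x + g x) ≤
      2 * normSq G ℓ em μ f + 2 * normSq G ℓ em μ g := by
  have := hcs.isBorel
  have h2 : ∫⁻ x, ENNReal.ofReal ((f x + g x) ^ 2) ∂μ ≤
      2 * ∫⁻ x, ENNReal.ofReal (f x ^ 2) ∂μ + 2 * ∫⁻ x, ENNReal.ofReal (g x ^ 2) ∂μ :=
    lintegral_sq_le_of_ae_le_add (Eventually.of_forall fun x => abs_add_le _ _)
      hf.1.measurable.aemeasurable
  refine (add_le_add (hf.dirEnergy_add_le hcs hg) h2).trans_eq ?_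
  simp only [normSq]
  ring

theorem EdgeAC.normSq_const_mul {f : X → ℝ} (hcs : IsCableSystem G ℓ μ vtx em) [Countable V]
    (hf : EdgeAC G ℓ em f) (c : ℝ) :
    normSq G ℓ em μ (fun x => c * f x) = ENNReal.ofReal (c ^ 2) * normSq G ℓ em μ f := by
  simp only [normSq]
  rw [hf.dirEnergy_const_mul hcs, mul_add, ← lintegral_const_mul' _ _ ENNReal.ofReal_ne_top]
  simp only [mul_pow, ENNReal.ofReal_mul (sq_nonneg c)]

theorem dirEnergy_zero (hcs : IsCableSystem G ℓ μ vtx em) [Countable V] :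
    dirEnergy G ℓ em μ (fun _ : X => (0 : ℝ)) = 0 := by
  have := (edgeAC_zero (G := G) (ℓ := ℓ) (em := em)).dirEnergy_const_mul hcs 0
  simpa using this

theorem tendsto_dirEnergy_of_normSq {f : X → ℝ} {F : ℕ → X → ℝ}
    (h : Tendsto (fun n => normSq G ℓ em μ (fun x => F n x - f x)) atTop (nhds 0)) :
    Tendsto (fun n => dirEnergy G ℓ em μ (fun x => F n x - f x)) atTop (nhds 0) :=
  tendsto_of_tendsto_of_tendsto_of_le_of_le tendsto_const_nhds h (fun _ => zero_le)
    fun _ => le_self_add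

theorem tendsto_lintegral_sq_of_normSq {f : X → ℝ} {F : ℕ → X → ℝ}
    (h : Tendsto (fun n => normSq G ℓ em μ (fun x => F n x - f x)) atTop (nhds 0)) :
    Tendsto (fun n => ∫⁻ x, ENNReal.ofReal ((F n x - f x) ^ 2) ∂μ) atTop (nhds 0) :=
  tendsto_of_tendsto_of_tendsto_of_le_of_le tendsto_const_nhds h (fun _ => zero_le)
    fun _ => le_add_self

namespace MemFD

variable {Dom : Set X} {f g : X → ℝ}

theorem of_edgeAC (hcs : IsCableSystem G ℓ μ vtx em) {F : ℕ → X → ℝ}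
    (hF : ∀ n, EdgeAC G ℓ em (F n)) (hsupp : ∀ n, HasCompactSupport (F n))
    (hDom : ∀ n, tsupport (F n) ⊆ Dom) (hE : ∀ n, dirEnergy G ℓ em μ (F n) < ⊤)
    (hlim : Tendsto (fun n => normSq G ℓ em μ (fun x => F n x - f x)) atTop (nhds 0)) :
    MemFD G ℓ em μ Dom f :=
  ⟨F, fun n => ⟨⟨_, hcs.hasGradMod_gradMod (hF n)⟩, hsupp n, hDom n, hE n⟩, hlim⟩

theorem exists_approx (hcs : IsCableSystem G ℓ μ vtx em) (hf : MemFD G ℓ em μ Dom f) :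
    EdgeAC G ℓ em f ∧ ∃ F : ℕ → X → ℝ, (∀ n, EdgeAC G ℓ em (F n)) ∧
      (∀ n, HasCompactSupport (F n)) ∧ (∀ n, tsupport (F n) ⊆ Dom) ∧
      (∀ n, dirEnergy G ℓ em μ (F n) < ⊤) ∧
      Tendsto (fun n => normSq G ℓ em μ (fun x => F n x - f x)) atTop (nhds 0) := by
  obtain ⟨F, hF, hlim⟩ := hf
  have hAC : ∀ n, EdgeAC G ℓ em (F n) := fun n => (hF n).1.choose_spec.edgeAC hcs
  obtain ⟨n, hn⟩ := (hlim.eventually_lt_const ENNReal.zero_lt_top).exists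
  have hd := edgeAC_of_dirEnergy_lt_top hcs (lt_of_le_of_lt le_self_add hn)
  refine ⟨?_, F, hAC, fun n => (hF n).2.1, fun n => (hF n).2.2.1, fun n => (hF n).2.2.2, hlim⟩
  simpa using (hAC n).sub hd

theorem mono {Dom' : Set X} (hf : MemFD G ℓ em μ Dom f) (h : Dom ⊆ Dom') :
    MemFD G ℓ em μ Dom' f := by
  obtain ⟨F, hF, hlim⟩ := hf
  exact ⟨F, fun n => ⟨(hF n).1, (hF n).2.1, (hF n).2.2.1.trans h, (hF n).2.2.2⟩, hlim⟩

protected theorem zero (hcs : IsCableSystem G ℓ μ vtx em) [Countable V] :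
    MemFD G ℓ em μ Dom (fun _ => 0) := by
  have h0 := dirEnergy_zero (μ := μ) hcs
  have hs : tsupport (fun _ : X => (0 : ℝ)) = ∅ := by simp
  refine of_edgeAC hcs (F := fun _ _ => 0) (fun _ => edgeAC_zero) (fun _ => ?_) (fun _ => ?_)
    (fun _ => by simp [h0]) ?_
  · exact HasCompactSupport.zero
  · simp
  · simp [normSq, h0]

theorem add (hcs : IsCableSystem G ℓ μ vtx em) [Countable V] (hf : MemFD G ℓ em μ Dom f)
    (hg : MemFD G ℓ em μ Dom g) : MemFD G ℓ em μ Dom (fun x => f x + g x) := by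
  obtain ⟨hfA, F, hF1, hF2, hF3, hF4, hF5⟩ := hf.exists_approx hcs
  obtain ⟨hgA, H, hH1, hH2, hH3, hH4, hH5⟩ := hg.exists_approx hcs
  refine of_edgeAC hcs (F := fun n x => F n x + H n x) (fun n => (hF1 n).add (hH1 n))
    (fun n => (hF2 n).add (hH2 n))
    (fun n => (tsupport_add _ _).trans (union_subset (hF3 n) (hH3 n)))
    (fun n => ((hF1 n).dirEnergy_add_le hcs (hH1 n)).trans_lt ?_) ?_
  · exact ENNReal.add_lt_top.2 ⟨ENNReal.mul_lt_top (by simp) (hF4 n),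
      ENNReal.mul_lt_top (by simp) (hH4 n)⟩
  · have hlim := (ENNReal.Tendsto.const_mul hF5 (Or.inr (ENNReal.ofNat_ne_top (n := 2)))).add
      (ENNReal.Tendsto.const_mul hH5 (Or.inr (ENNReal.ofNat_ne_top (n := 2))))
    rw [mul_zero, add_zero] at hlim
    refine tendsto_of_tendsto_of_tendsto_of_le_of_le tendsto_const_nhds hlim
      (fun _ => zero_le) fun n => ?_
    have := ((hF1 n).sub hfA).normSq_add_le hcs ((hH1 n).sub hgA)
    refine le_of_eq_of_le ?_ this
    congr 1
    funext x
    ring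

theorem const_mul (hcs : IsCableSystem G ℓ μ vtx em) [Countable V] (hf : MemFD G ℓ em μ Dom f)
    (c : ℝ) : MemFD G ℓ em μ Dom (fun x => c * f x) := by
  obtain ⟨hfA, F, hF1, hF2, hF3, hF4, hF5⟩ := hf.exists_approx hcs
  refine of_edgeAC hcs (F := fun n x => c * F n x) (fun n => (hF1 n).const_mul c)
    (fun n => (hF2 n).mul_left) (fun n => (tsupport_mul_subset_right).trans (hF3 n))
    (fun n => ?_) ?_
  · rw [(hF1 n).dirEnergy_const_mul hcs]
    exact ENNReal.mul_lt_top (by simp) (hF4 n)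
  · have hlim := ENNReal.Tendsto.const_mul hF5 (Or.inr (ENNReal.ofReal_ne_top (r := c ^ 2)))
    rw [mul_zero] at hlim
    refine hlim.congr fun n => ?_
    rw [← ((hF1 n).sub hfA).normSq_const_mul hcs c]
    simp only [mul_sub]

theorem exists_subseq_tendsto_ae (hcs : IsCableSystem G ℓ μ vtx em) {F : ℕ → X → ℝ}
    (hF : ∀ n, EdgeAC G ℓ em (F n)) (hf : EdgeAC G ℓ em f)
    (h : Tendsto (fun n => normSq G ℓ em μ (fun x => F n x - f x)) atTop (nhds 0)) :
    ∃ φ : ℕ → ℕ, StrictMono φ ∧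
      ∀ᵐ y ∂μ, Tendsto (fun n => F (φ n) y) atTop (nhds (f y)) := by
  have := hcs.isBorel
  refine (tendstoInMeasure_of_tendsto_eLpNorm (p := 2) (by simp)
    (fun n => (hF n).1.aestronglyMeasurable) hf.1.aestronglyMeasurable ?_).exists_seq_tendsto_ae
  have h1 := tendsto_lintegral_sq_of_normSq h
  have h2 := (ENNReal.continuous_rpow_const (y := 1 / 2)).tendsto 0 |>.comp h1
  rw [ENNReal.zero_rpow_of_pos (by norm_num)] at h2
  refine h2.congr fun n => ?_
  rw [eLpNorm_eq_lintegral_rpow_enorm_toReal (by simp) (by simp)]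
  simp only [Function.comp_apply, ENNReal.toReal_ofNat]
  congr 1
  refine lintegral_congr fun x => ?_
  rw [Pi.sub_apply, ← sq_abs, ENNReal.ofReal_pow (abs_nonneg _), ← Real.enorm_eq_ofReal_abs]
  norm_cast

theorem ae_eq_zero (hcs : IsCableSystem G ℓ μ vtx em) (hf : MemFD G ℓ em μ Dom f) :
    ∀ᵐ y ∂μ, y ∉ Dom → f y = 0 := by
  obtain ⟨hfA, F, hF1, hF2, hF3, hF4, hF5⟩ := hf.exists_approx hcs
  obtain ⟨φ, -, hae⟩ := exists_subseq_tendsto_ae hcs hF1 hfA hF5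
  filter_upwards [hae] with y hy hyD
  have h0 : ∀ n, F (φ n) y = 0 := fun n => image_eq_zero_of_notMem_tsupport fun h =>
    hyD (hF3 _ h)
  simp only [h0] at hy
  exact tendsto_nhds_unique hy tendsto_const_nhds

theorem lipschitz_comp (hcs : IsCableSystem G ℓ μ vtx em) [Countable V]
    (hf : MemFD G ℓ em μ Dom f) (hfE : dirEnergy G ℓ em μ f < ⊤) {T : ℝ → ℝ} {K : ℝ≥0}
    (hT : ContDiff ℝ 1 T) (hT0 : T 0 = 0) (hL : LipschitzWith K T)
    (hK : ∀ s, |deriv T s| ≤ K) : MemFD G ℓ em μ Dom (fun x => T (f x)) := by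
  have := hcs.isBorel
  obtain ⟨hfA, F, hF1, hF2, hF3, hF4, hF5⟩ := hf.exists_approx hcs
  obtain ⟨φ, hφ, hae⟩ := exists_subseq_tendsto_ae hcs hF1 hfA hF5
  have hTd : Differentiable ℝ T := hT.differentiable (by norm_num)
  have hT' : Continuous (deriv T) := hT.continuous_deriv le_rfl
  refine of_edgeAC hcs (F := fun n x => T (F (φ n) x)) (fun n => (hF1 _).lipschitz_comp hL)
    (fun n => (hF2 _).comp_left hT0)
    (fun n => (closure_mono (Function.support_comp_subset hT0 _)).trans (hF3 (φ n)))
    (fun n => ((hF1 _).dirEnergy_comp_le hcs hTd hL hK).trans_lt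
      (ENNReal.mul_lt_top (by simp) (hF4 _))) ?_
  have hdom : Tendsto (fun n => ∫⁻ y, ENNReal.ofReal
      ((|deriv T (F (φ n) y) - deriv T (f y)| * gradMod G ℓ em f y) ^ 2) ∂μ) atTop (nhds 0) := by
    rw [← lintegral_zero (α := X) (μ := μ)]
    have hmeas := hcs.aemeasurable_gradMod f
    refine tendsto_lintegral_of_dominated_convergence'
      (fun y => ENNReal.ofReal ((2 * K) ^ 2) * ENNReal.ofReal (gradMod G ℓ em f y ^ 2))
      (fun n => ?_) (fun n => Eventually.of_forall fun y => ?_) ?_ ?_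
    · have hc : Continuous fun y => |deriv T (F (φ n) y) - deriv T (f y)| :=
        ((hT'.comp (hF1 _).1).sub (hT'.comp hfA.1)).abs
      exact ((hc.measurable.aemeasurable.mul hmeas).pow_const 2).ennreal_ofReal
    · have h0 := gradMod_nonneg (G := G) (ℓ := ℓ) (em := em) f y
      dsimp only
      rw [← ENNReal.ofReal_mul (by positivity), ← mul_pow]
      gcongr
      calc |deriv T (F (φ n) y) - deriv T (f y)| ≤ |deriv T (F (φ n) y)| + |deriv T (f y)| :=
            abs_sub _ _
        _ ≤ 2 * K := by linarith [hK (F (φ n) y), hK (f y)]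
    · rw [lintegral_const_mul' _ _ ENNReal.ofReal_ne_top, ← hfA.dirEnergy_eq hcs]
      exact (ENNReal.mul_lt_top ENNReal.ofReal_lt_top hfE).ne
    · filter_upwards [hae] with y hy
      have h1 : Tendsto (fun n => deriv T (F (φ n) y)) atTop (nhds (deriv T (f y))) :=
        (hT'.tendsto _).comp hy
      have h2 := (((h1.sub_const (deriv T (f y))).abs.mul_const (gradMod G ℓ em f y)).pow 2)
      simpa [Function.comp_def] using (ENNReal.continuous_ofReal.tendsto _).comp h2
  have hbound : Tendsto (fun n => (2 * (ENNReal.ofReal ((K : ℝ) ^ 2) *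
        dirEnergy G ℓ em μ (fun x => F (φ n) x - f x)) +
      2 * ∫⁻ y, ENNReal.ofReal
        ((|deriv T (F (φ n) y) - deriv T (f y)| * gradMod G ℓ em f y) ^ 2) ∂μ) +
      ENNReal.ofReal ((K : ℝ) ^ 2) * ∫⁻ x, ENNReal.ofReal ((F (φ n) x - f x) ^ 2) ∂μ)
      atTop (nhds 0) := by
    have hK2 : ENNReal.ofReal ((K : ℝ) ^ 2) ≠ ⊤ := ENNReal.ofReal_ne_top
    have h2 : (2 : ℝ≥0∞) ≠ ⊤ := ENNReal.ofNat_ne_top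
    have e1 := ENNReal.Tendsto.const_mul (ENNReal.Tendsto.const_mul
      ((tendsto_dirEnergy_of_normSq hF5).comp hφ.tendsto_atTop) (Or.inr hK2)) (Or.inr h2)
    have e2 := ENNReal.Tendsto.const_mul hdom (Or.inr h2)
    have e3 := ENNReal.Tendsto.const_mul
      ((tendsto_lintegral_sq_of_normSq hF5).comp hφ.tendsto_atTop) (Or.inr hK2)
    simpa using (e1.add e2).add e3
  refine tendsto_of_tendsto_of_tendsto_of_le_of_le tendsto_const_nhds hbound
    (fun _ => zero_le) fun n => add_le_add ?_ ?_
  · have hFA := hF1 (φ n)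
    rw [← hFA.sub hfA |>.dirEnergy_const_mul hcs (K : ℝ),
      ((hFA.lipschitz_comp hL).sub (hfA.lipschitz_comp hL)).dirEnergy_eq hcs,
      ((hFA.sub hfA).const_mul (K : ℝ)).dirEnergy_eq hcs]
    refine lintegral_sq_le_of_ae_le_add ?_ (hcs.aemeasurable_gradMod _)
    filter_upwards [hFA.gradMod_comp_sub_le hcs hfA hTd hK,
      (hFA.sub hfA).gradMod_const_mul hcs (K : ℝ)] with y h1 h2
    rw [h2, abs_of_nonneg (gradMod_nonneg _ _), abs_mul, abs_mul, abs_abs, abs_abs,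
      abs_of_nonneg (gradMod_nonneg _ y), abs_of_nonneg (gradMod_nonneg _ y),
      abs_of_nonneg K.coe_nonneg]
    exact h1
  · rw [← lintegral_const_mul' _ _ ENNReal.ofReal_ne_top]
    refine lintegral_mono fun x => ?_
    rw [← ENNReal.ofReal_mul (by positivity), ← mul_pow, ← sq_abs]
    apply ENNReal.ofReal_le_ofReal
    rw [← sq_abs ((K : ℝ) * _), abs_mul, abs_of_nonneg K.coe_nonneg]
    gcongr
    simpa [Real.dist_eq] using hL.dist_le_mul (F (φ n) x) (f x)

end MemFD

theorem Real.deriv_smoothTransition_of_nonpos {s : ℝ} (hs : s ≤ 0) :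
    deriv Real.smoothTransition s = 0 := by
  refine IsLocalMin.deriv_eq_zero (Eventually.of_forall fun y => ?_)
  simp only [Real.smoothTransition.zero_of_nonpos hs]
  exact Real.smoothTransition.nonneg y

theorem Real.deriv_smoothTransition_of_one_le {s : ℝ} (hs : 1 ≤ s) :
    deriv Real.smoothTransition s = 0 := by
  refine IsLocalMax.deriv_eq_zero (Eventually.of_forall fun y => ?_)
  simp only [Real.smoothTransition.one_of_one_le hs]
  exact Real.smoothTransition.le_one y

theorem Real.exists_abs_deriv_smoothTransition_le :
    ∃ K : ℝ≥0, 1 ≤ K ∧ ∀ s, |deriv Real.smoothTransition s| ≤ K := by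
  have hc : Continuous (deriv Real.smoothTransition) :=
    (Real.smoothTransition.contDiff (n := 1)).continuous_deriv le_rfl
  obtain ⟨B, hB⟩ := isCompact_Icc.exists_bound_of_continuousOn
    (hc.continuousOn (s := Icc (0 : ℝ) 1))
  refine ⟨max 1 B.toNNReal, le_max_left _ _, fun s => ?_⟩
  rcases le_total s 0 with h0 | h0
  · rw [Real.deriv_smoothTransition_of_nonpos h0, abs_zero]
    exact NNReal.coe_nonneg _
  rcases le_total 1 s with h1 | h1
  · rw [Real.deriv_smoothTransition_of_one_le h1, abs_zero]
    exact NNReal.coe_nonneg _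
  calc |deriv Real.smoothTransition s| ≤ B := hB s ⟨h0, h1⟩
    _ ≤ B.toNNReal := Real.le_coe_toNNReal B
    _ ≤ (max 1 B.toNNReal : ℝ≥0) := by exact_mod_cast le_max_right _ _

/-- A competitor for the capacity can be replaced, at the cost of a multiplicative constant in the
energy, by one which equals `1` on `A` and whose gradient lives in `Dom \ A`. -/
theorem exists_cutoff_of_capacity_lt (hcs : IsCableSystem G ℓ μ vtx em) [Countable V]
    {K : ℝ≥0} (hK : ∀ s, |deriv Real.smoothTransition s| ≤ K) {Dom A : Set X} {c : ℝ}
    (hcap : capacity G ℓ em μ Dom A < ENNReal.ofReal c) :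
    ∃ g : X → ℝ, MemFD G ℓ em μ Dom g ∧ (∀ᵐ y ∂μ, y ∉ Dom → gradMod G ℓ em g y = 0) ∧
      (∀ᵐ y ∂μ, y ∈ A → gradMod G ℓ em g y = 0) ∧
      dirEnergy G ℓ em μ g ≤ ENNReal.ofReal ((K : ℝ) ^ 2 * c) ∧ ∀ y ∈ A, g y = 1 := by
  simp only [capacity, iInf_lt_iff] at hcap
  obtain ⟨f, ⟨hf, U, -, hAU, hU⟩, hE⟩ := hcap
  have hT : ContDiff ℝ 1 Real.smoothTransition := Real.smoothTransition.contDiff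
  have hTd : Differentiable ℝ Real.smoothTransition := hT.differentiable (by norm_num)
  have hL : LipschitzWith K Real.smoothTransition :=
    lipschitzWith_of_nnnorm_deriv_le hTd fun s => by
      rw [← NNReal.coe_le_coe, coe_nnnorm]
      exact hK s
  have hfA := (hf.exists_approx hcs).1
  refine ⟨fun y => Real.smoothTransition (f y),
    hf.lipschitz_comp hcs (hE.trans ENNReal.ofReal_lt_top) hT Real.smoothTransition.zero hL hK,
    ?_, ?_, ?_, fun y hy => Real.smoothTransition.one_of_one_le (hU y (hAU hy))⟩
  · filter_upwards [hfA.gradMod_comp hcs hTd, hf.ae_eq_zero hcs] with y h1 h2 hy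
    rw [h1, h2 hy, Real.deriv_smoothTransition_of_nonpos le_rfl, abs_zero, zero_mul]
  · filter_upwards [hfA.gradMod_comp hcs hTd] with y h1 hy
    rw [h1, Real.deriv_smoothTransition_of_one_le (hU y (hAU hy)), abs_zero, zero_mul]
  · refine (hfA.dirEnergy_comp_le hcs hTd hL hK).trans ?_
    rw [ENNReal.ofReal_mul (sq_nonneg _)]
    gcongr

theorem EdgeAC.dirEnergy_add_le_of_disjoint {f g : X → ℝ} (hcs : IsCableSystem G ℓ μ vtx em)
    [Countable V] (hf : EdgeAC G ℓ em f) (hg : EdgeAC G ℓ em g)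
    (hd : ∀ᵐ y ∂μ, gradMod G ℓ em f y = 0 ∨ gradMod G ℓ em g y = 0) :
    dirEnergy G ℓ em μ (fun x => f x + g x) ≤ dirEnergy G ℓ em μ f + dirEnergy G ℓ em μ g := by
  rw [hf.dirEnergy_eq hcs, hg.dirEnergy_eq hcs, (hf.add hg).dirEnergy_eq hcs,
    ← lintegral_add_left' ((hcs.aemeasurable_gradMod f).pow_const 2).ennreal_ofReal]
  refine lintegral_mono_ae ?_
  filter_upwards [hd, hf.gradMod_add_le hcs hg] with y h1 h2
  rw [← ENNReal.ofReal_add (sq_nonneg _) (sq_nonneg _)]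
  apply ENNReal.ofReal_le_ofReal
  refine (pow_le_pow_left₀ (gradMod_nonneg _ _) h2 2).trans ?_
  rcases h1 with h | h <;> simp [h]

/-- Summing cutoff functions with gradients in the successive annuli
`B(x, M^(i+1) r) \ B(x, M^i r)`. -/
theorem exists_sum_cutoff (hcs : IsCableSystem G ℓ μ vtx em) [Countable V] {M r B : ℝ}
    (hM : 1 ≤ M) (hr : 0 < r) (hB : 0 ≤ B) {x : X}
    (hcut : ∀ ρ, r ≤ ρ → ∃ g : X → ℝ, MemFD G ℓ em μ (ball x (M * ρ)) g ∧
      (∀ᵐ y ∂μ, y ∉ ball x (M * ρ) → gradMod G ℓ em g y = 0) ∧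
      (∀ᵐ y ∂μ, y ∈ ball x ρ → gradMod G ℓ em g y = 0) ∧
      dirEnergy G ℓ em μ g ≤ ENNReal.ofReal B ∧ ∀ y ∈ ball x ρ, g y = 1) (n : ℕ) :
    ∃ S : X → ℝ, MemFD G ℓ em μ (ball x (M ^ n * r)) S ∧
      (∀ᵐ y ∂μ, y ∉ ball x (M ^ n * r) → gradMod G ℓ em S y = 0) ∧
      dirEnergy G ℓ em μ S ≤ ENNReal.ofReal (n * B) ∧ ∀ y ∈ ball x r, S y = n := by
  induction n with
  | zero =>
    refine ⟨fun _ => 0, MemFD.zero hcs, Eventually.of_forall fun y _ => gradMod_zero y, ?_, ?_⟩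
    · simp [dirEnergy_zero hcs]
    · simp
  | succ n ih =>
    obtain ⟨S, hS, hS0, hSE, hS1⟩ := ih
    have hρ : r ≤ M ^ n * r := le_mul_of_one_le_left hr.le (one_le_pow₀ hM)
    obtain ⟨g, hg, hg0, hg1, hgE, hgA⟩ := hcut _ hρ
    have hMρ : M * (M ^ n * r) = M ^ (n + 1) * r := by ring
    have hle : M ^ n * r ≤ M ^ (n + 1) * r := by
      rw [← hMρ]
      exact le_mul_of_one_le_left (hr.le.trans hρ) hM
    rw [hMρ] at hg hg0
    have hSA := (hS.exists_approx hcs).1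
    have hgAC := (hg.exists_approx hcs).1
    refine ⟨fun y => S y + g y, (hS.mono (ball_subset_ball hle)).add hcs hg, ?_, ?_, ?_⟩
    · filter_upwards [hS0, hg0, hSA.gradMod_add_le hcs hgAC] with y h1 h2 h3 hy
      rw [h1 fun h => hy (ball_subset_ball hle h), h2 hy, add_zero] at h3
      exact le_antisymm h3 (gradMod_nonneg _ _)
    · refine (hSA.dirEnergy_add_le_of_disjoint hcs hgAC ?_).trans ?_
      · filter_upwards [hS0, hg1] with y h1 h2
        by_cases hy : y ∈ ball x (M ^ n * r)
        · exact Or.inr (h2 hy)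
        · exact Or.inl (h1 hy)
      · refine (add_le_add hSE hgE).trans_eq ?_
        rw [← ENNReal.ofReal_add (by positivity) hB]
        congr 1
        push_cast
        ring
    · intro y hy
      dsimp only
      rw [hS1 y hy, hgA y (ball_subset_ball hρ hy)]
      push_cast
      ring

end CableCalculus

/-- **Lemma (iterated capacity bound).**  Let `(X, d_ℓ, μ)` be the cable system of a
connected, locally finite, simple graph with a complete length function `ℓ`.  If the
capacity upper bound `(cap_≤)` holds with constants `C, M`, then there is `C₁ > 0` such
that `Cap_{B(x,R)}(B(x,r)) ≤ C₁ (log (R/r))⁻¹` for all `x ∈ X`, `r ≥ 1` and `R ≥ M r`. -/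
theorem capacity_le_inv_log
    {V X : Type*} [MetricSpace X] [MeasurableSpace X] [CompleteSpace X]
    (G : SimpleGraph V) (hconn : G.Connected) (hlf : ∀ v : V, (G.neighborSet v).Finite)
    (ℓ : V → V → ℝ) (μ : Measure X) (vtx : V → X) (em : V → V → ℝ → X)
    (hcs : IsCableSystem G ℓ μ vtx em)
    (C M : ℝ) (hC : 1 ≤ C) (hM : 1 < M)
    (hcap : ∀ (x : X) (r : ℝ), 1 ≤ r →
      capacity G ℓ em μ (ball x (M * r)) (ball x r) ≤ ENNReal.ofReal C) :
    ∃ C₁ : ℝ, 0 < C₁ ∧ ∀ (x : X) (r R : ℝ), 1 ≤ r → M * r ≤ R →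
      capacity G ℓ em μ (ball x R) (ball x r) ≤
        ENNReal.ofReal (C₁ / Real.log (R / r)) := by
  have : Countable V := hconn.countable_of_finite_neighborSet hlf
  obtain ⟨K, hK1, hK⟩ := Real.exists_abs_deriv_smoothTransition_le
  have hK1' : (1 : ℝ) ≤ K := by exact_mod_cast hK1
  set B : ℝ := (K : ℝ) ^ 2 * (C + 1)
  have hB : 0 < B := by positivity
  have hlogM : 0 < Real.log M := Real.log_pos hM
  refine ⟨2 * B * Real.log M, by positivity, fun x r R hr hR => ?_⟩
  have hr0 : 0 < r := by linarith
  have hMR : M ≤ R / r := (le_div_iff₀ hr0).2 hR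
  have hlog : Real.log M ≤ Real.log (R / r) := Real.log_le_log (by linarith) hMR
  set q : ℝ := Real.log (R / r) / Real.log M
  have hq1 : 1 ≤ q := (one_le_div hlogM).2 hlog
  set n : ℕ := ⌊q⌋₊
  have hn1 : (1 : ℝ) ≤ n := by exact_mod_cast Nat.one_le_floor_iff q |>.2 hq1
  have hnq : (n : ℝ) ≤ q := Nat.floor_le (by linarith)
  have hqn : q ≤ 2 * n := by linarith [Nat.lt_floor_add_one q]
  have hpow : M ^ n * r ≤ R := by
    rw [← le_div_iff₀ hr0, ← Real.log_le_log_iff (by positivity) (by linarith), Real.log_pow]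
    exact (le_div_iff₀ hlogM).1 hnq
  obtain ⟨S, hS, -, hSE, hS1⟩ := exists_sum_cutoff hcs (B := B) hM.le hr0 hB.le (x := x)
    (fun ρ hρ => exists_cutoff_of_capacity_lt hcs hK
      ((hcap x ρ (hr.trans hρ)).trans_lt
        ((ENNReal.ofReal_lt_ofReal_iff (by linarith)).2 (by linarith)))) n
  have hSA := (hS.exists_approx hcs).1
  have hcomp : capacity G ℓ em μ (ball x R) (ball x r) ≤
      dirEnergy G ℓ em μ (fun y => (n : ℝ)⁻¹ * S y) := by
    refine iInf₂_le _ ⟨(hS.mono (ball_subset_ball hpow)).const_mul hcs _, ball x r, isOpen_ball,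
      Subset.rfl, fun y hy => ?_⟩
    dsimp only
    rw [hS1 y hy, inv_mul_cancel₀ (by positivity)]
  refine hcomp.trans ?_
  rw [hSA.dirEnergy_const_mul hcs]
  refine (mul_le_mul_right hSE _).trans ?_
  rw [← ENNReal.ofReal_mul (sq_nonneg _)]
  apply ENNReal.ofReal_le_ofReal
  have hlogR : 0 < Real.log (R / r) := hlogM.trans_le hlog
  have h1 : (n : ℝ)⁻¹ ^ 2 * (n * B) = B / n := by
    field_simp
  rw [h1, div_le_div_iff₀ (by positivity) hlogR]
  have h2 : Real.log (R / r) ≤ 2 * n * Real.log M := (div_le_iff₀ hlogM).1 hqn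
  nlinarith [mul_le_mul_of_nonneg_left h2 hB.le]

end
end

section
/- Let G be a connected, locally finite, simple graph of polynomial growth with volume growth exponent d ≥ 2, and let (X,d₁,μ₁) be its cable system with unit length function ℓ ≡ 1. Assume that (X,d₁,μ₁) with its Dirichlet energy satisfies the capacity upper bound (cap_≤) and the Poincaré inequality PI(Ψ) with Ψ(r) = r² ∨ r^d. Then (X,d₁) is annular quasi-convex at large scales. -/
open MeasureTheory Set Metric Filter
open scoped ENNReal NNReal

noncomputable section

variable {V : Type*} {X : Type*}

/-! ### Functions of one variable controlled by an integral -/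

/-- A function whose increments are bounded by the integral of `k` is absolutely continuous. -/
lemma absolutelyContinuousOnInterval_of_abs_sub_le_integral {v k : ℝ → ℝ}
    (hk : IntervalIntegrable k volume 0 1)
    (h : ∀ s t, 0 ≤ s → s ≤ t → t ≤ 1 → |v t - v s| ≤ ∫ x in s..t, k x) :
    AbsolutelyContinuousOnInterval v 0 1 := by
  have hK := hk.absolutelyContinuousOnInterval_intervalIntegral (c := 0) (by simp)
  have hsub : ∀ a ∈ uIcc (0:ℝ) 1, ∀ b ∈ uIcc (0:ℝ) 1,
      dist (v a) (v b) ≤ dist (∫ x in (0:ℝ)..a, k x) (∫ x in (0:ℝ)..b, k x) := by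
    intro a ha b hb
    have hint : ∀ c ∈ uIcc (0:ℝ) 1, IntervalIntegrable k volume 0 c := fun c hc =>
      hk.mono_set (uIcc_subset_uIcc (by simp) hc)
    wlog hab : a ≤ b generalizing a b
    · rw [dist_comm (v a), dist_comm (∫ x in (0:ℝ)..a, k x)]
      exact this b hb a ha (le_of_not_ge hab)
    rw [dist_comm, dist_comm (∫ x in (0:ℝ)..a, k x), Real.dist_eq, Real.dist_eq,
      intervalIntegral.integral_interval_sub_left (hint b hb) (hint a ha)]
    rw [uIcc_of_le zero_le_one] at ha hb
    exact (h a b ha.1 hab hb.2).trans (le_abs_self _)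
  refine squeeze_zero' (Eventually.of_forall fun E => Finset.sum_nonneg fun _ _ => dist_nonneg)
    ?_ hK
  filter_upwards [mem_inf_of_right (mem_principal_self _)] with E hE
  exact Finset.sum_le_sum fun i hi => hsub _ (hE.1 i hi).1 _ (hE.1 i hi).2

/-- The derivative of a function whose increments are bounded by the integral of `k` is bounded
by `k` almost everywhere. -/
lemma ae_abs_deriv_le_of_abs_sub_le_integral {v k : ℝ → ℝ}
    (hk : IntervalIntegrable k volume 0 1) (hk0 : ∀ t, 0 ≤ k t)
    (h : ∀ s t, 0 ≤ s → s ≤ t → t ≤ 1 → |v t - v s| ≤ ∫ x in s..t, k x) :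
    ∀ᵐ t, t ∈ Icc (0:ℝ) 1 → |deriv v t| ≤ k t := by
  have h0 : ∀ᵐ t : ℝ, t ≠ 0 := by simp [ae_iff, measure_singleton]
  have h1 : ∀ᵐ t : ℝ, t ≠ 1 := by simp [ae_iff, measure_singleton]
  filter_upwards [hk.ae_hasDerivAt_integral, h0, h1] with t ht ht0 ht1 htI
  by_cases hd : DifferentiableAt ℝ v t
  swap
  · simpa [deriv_zero_of_not_differentiableAt hd] using hk0 t
  have hK := ht (by rwa [uIcc_of_le zero_le_one]) 0 (by simp)
  have hlim1 := (hasDerivAt_iff_tendsto_slope.1 hd.hasDerivAt).abs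
  have hlim2 := (hasDerivAt_iff_tendsto_slope.1 hK).abs
  rw [abs_of_nonneg (hk0 t)] at hlim2
  refine le_of_tendsto_of_tendsto hlim1 hlim2 ?_
  have hmem : Icc (0:ℝ) 1 ∈ nhds t :=
    Icc_mem_nhds (lt_of_le_of_ne htI.1 (Ne.symm ht0)) (lt_of_le_of_ne htI.2 ht1)
  filter_upwards [mem_nhdsWithin_of_mem_nhds hmem] with y hy
  have hint : ∀ c ∈ Icc (0:ℝ) 1, IntervalIntegrable k volume 0 c := fun c hc =>
    hk.mono_set (uIcc_subset_uIcc (by simp) (by rwa [uIcc_of_le zero_le_one]))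
  have key : |v y - v t| ≤ |(∫ x in (0:ℝ)..y, k x) - ∫ x in (0:ℝ)..t, k x| := by
    rcases le_total t y with hty | hty
    · rw [intervalIntegral.integral_interval_sub_left (hint y hy) (hint t htI)]
      exact (h t y htI.1 hty hy.2).trans (le_abs_self _)
    · rw [abs_sub_comm, abs_sub_comm (∫ x in (0:ℝ)..y, k x),
        intervalIntegral.integral_interval_sub_left (hint t htI) (hint y hy)]
      exact (h y t hy.1 hty htI.2).trans (le_abs_self _)
  simp only [slope_def_field, abs_div]
  gcongr

/-! ### Upper gradients on a cable system with unit lengths -/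

/-- `k` is an *upper gradient* of the continuous function `f` along the unit-length edges: the
increments of `f` along every edge are bounded by the integral of `k`. -/
def HasUpperGrad [TopologicalSpace X] (G : SimpleGraph V) (em : V → V → ℝ → X)
    (f k : X → ℝ) : Prop :=
  Continuous f ∧ (∀ x, 0 ≤ k x) ∧ ∀ u v, G.Adj u v →
    IntervalIntegrable (fun t => k (em u v t)) volume 0 1 ∧
    ∀ s t, 0 ≤ s → s ≤ t → t ≤ 1 → |f (em u v t) - f (em u v s)| ≤ ∫ x in s..t, k (em u v x)

lemma HasGradMod.hasUpperGrad [TopologicalSpace X] {G : SimpleGraph V} {em : V → V → ℝ → X}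
    {f g : X → ℝ} (h : HasGradMod G (fun _ _ => 1) em f g) : HasUpperGrad G em f g := by
  obtain ⟨hf, hg, H⟩ := h
  refine ⟨hf, hg, fun u v huv => ?_⟩
  obtain ⟨h, hint, hae, heq⟩ := H u v huv
  have hint' : IntervalIntegrable h volume 0 1 :=
    (intervalIntegrable_iff_integrableOn_Icc_of_le zero_le_one).2 hint
  have hae' : ∀ᵐ t, t ∈ Icc (0:ℝ) 1 → |h t| = g (em u v t) :=
    (ae_restrict_iff' measurableSet_Icc).1 hae
  refine ⟨hint'.abs.congr_ae ?_, fun s t hs hst ht => ?_⟩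
  · rw [uIoc_of_le zero_le_one]
    exact ae_restrict_of_ae_restrict_of_subset Ioc_subset_Icc_self hae
  · have hsub : ∀ c, 0 ≤ c → c ≤ 1 → IntervalIntegrable h volume 0 c := fun c h0 h1 =>
      hint'.mono_set (uIcc_subset_uIcc (by simp) (by rw [uIcc_of_le zero_le_one]; exact ⟨h0, h1⟩))
    rw [heq t ⟨hs.trans hst, ht⟩, heq s ⟨hs, hst.trans ht⟩,
      ← intervalIntegral.integral_of_le (hs.trans hst), ← intervalIntegral.integral_of_le hs,
      add_sub_add_left_eq_sub, intervalIntegral.integral_interval_sub_left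
        (hsub t (hs.trans hst) ht) (hsub s hs (hst.trans ht))]
    refine (intervalIntegral.abs_integral_le_integral_abs hst).trans_eq ?_
    refine intervalIntegral.integral_congr_ae ?_
    filter_upwards [hae'] with x hx hxm
    rw [uIoc_of_le hst] at hxm
    exact hx ⟨hs.trans hxm.1.le, hxm.2.trans ht⟩

lemma HasUpperGrad.abs_sub_le [TopologicalSpace X] {G : SimpleGraph V} {em : V → V → ℝ → X}
    {f k : X → ℝ} (h : HasUpperGrad G em f k) {u v : V}
    (huv : G.Adj u v) {s t : ℝ} (hs : s ∈ Icc (0:ℝ) 1) (ht : t ∈ Icc (0:ℝ) 1) :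
    |f (em u v s) - f (em u v t)| ≤ ∫ x in (0:ℝ)..1, k (em u v x) := by
  wlog hst : s ≤ t generalizing s t
  · rw [abs_sub_comm]
    exact this ht hs (le_of_not_ge hst)
  obtain ⟨hint, hle⟩ := h.2.2 u v huv
  rw [abs_sub_comm]
  refine (hle s t hs.1 hst ht.2).trans ?_
  exact intervalIntegral.integral_mono_interval hs.1 hst ht.2
    (Eventually.of_forall fun x => h.2.1 _) hint

open Classical in
/-- The length of the derivative of `f` at interior points of edges, and `0` elsewhere. -/
def edgeGrad (G : SimpleGraph V) (em : V → V → ℝ → X) (f : X → ℝ) (p : X) : ℝ :=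
  if h : ∃ q : V × V × ℝ, G.Adj q.1 q.2.1 ∧ q.2.2 ∈ Ioo (0:ℝ) 1 ∧ em q.1 q.2.1 q.2.2 = p then
    |deriv (fun t => f (em h.choose.1 h.choose.2.1 t)) h.choose.2.2|
  else 0

lemma edgeGrad_nonneg (G : SimpleGraph V) (em : V → V → ℝ → X) (f : X → ℝ) (p : X) :
    0 ≤ edgeGrad G em f p := by
  unfold edgeGrad
  split_ifs <;> positivity

namespace IsCableSystem

variable [MetricSpace X] [MeasurableSpace X] {G : SimpleGraph V} {μ : Measure X} {vtx : V → X}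
  {em : V → V → ℝ → X}

lemma continuousOn_edge (hcs : IsCableSystem G (fun _ _ => 1) μ vtx em) {u v : V}
    (huv : G.Adj u v) : ContinuousOn (em u v) (Icc 0 1) := by
  refine LipschitzOnWith.continuousOn (K := 1) (LipschitzOnWith.of_dist_le_mul fun s hs t ht => ?_)
  simpa [Real.dist_eq] using hcs.edge_lip u v huv s hs t ht

lemma measurableEmbedding_edge (hcs : IsCableSystem G (fun _ _ => 1) μ vtx em) {u v : V}
    (huv : G.Adj u v) : MeasurableEmbedding (fun t : Icc (0:ℝ) 1 => em u v t) := by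
  have := hcs.isBorel
  have hc : Continuous (fun t : Icc (0:ℝ) 1 => em u v t) :=
    continuousOn_iff_continuous_domRestrict.1 (hcs.continuousOn_edge huv)
  exact (hc.isClosedEmbedding fun a b hab =>
    Subtype.ext (hcs.edge_inj u v huv a.2 b.2 hab)).measurableEmbedding

/-- Integrals along an edge are bounded by integrals over the whole cable system. -/
lemma lintegral_edge_le (hcs : IsCableSystem G (fun _ _ => 1) μ vtx em) {u v : V}
    (huv : G.Adj u v) (F : X → ℝ≥0∞) :
    ∫⁻ t in Icc (0:ℝ) 1, F (em u v t) ≤ ∫⁻ x, F x ∂μ := by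
  have hemb := hcs.measurableEmbedding_edge huv
  rw [← lintegral_subtype_comap measurableSet_Icc (fun t => F (em u v t)),
    ← hemb.lintegral_map]
  refine lintegral_mono' (Measure.le_iff.2 fun S hS => ?_) le_rfl
  have hpre := hemb.measurable hS
  rw [hemb.map_apply, comap_subtype_coe_apply measurableSet_Icc]
  have hm : MeasurableSet (Subtype.val '' ((fun t : Icc (0:ℝ) 1 => em u v t) ⁻¹' S)) :=
    measurableSet_Icc.subtype_image hpre
  have := hcs.measure_edge u v huv _ hm (by rintro _ ⟨t, -, rfl⟩; exact t.2)
  rw [ENNReal.ofReal_one, one_mul] at this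
  rw [← this]
  refine measure_mono ?_
  rintro _ ⟨_, ⟨t, ht, rfl⟩, rfl⟩
  exact ht

/-- A property that holds almost everywhere on every edge holds almost everywhere. -/
lemma ae_of_ae_edge [Countable V] (hcs : IsCableSystem G (fun _ _ => 1) μ vtx em) {P : X → Prop}
    (h : ∀ u v, G.Adj u v → ∀ᵐ t, t ∈ Icc (0:ℝ) 1 → P (em u v t)) : ∀ᵐ x ∂μ, P x := by
  rw [ae_iff]
  have hsub : {x | ¬ P x} ⊆ ⋃ (u : V) (v : V) (_ : G.Adj u v),
      em u v '' (toMeasurable volume {t | ¬ (t ∈ Icc (0:ℝ) 1 → P (em u v t))} ∩ Icc 0 1) := by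
    intro x hx
    obtain ⟨u, v, s, huv, hs, rfl⟩ := hcs.cover x
    simp only [mem_iUnion]
    exact ⟨u, v, huv, s, ⟨subset_toMeasurable _ _ (fun hc => hx (hc hs)), hs⟩, rfl⟩
  refine measure_mono_null hsub (measure_iUnion_null fun u => measure_iUnion_null fun v =>
    measure_iUnion_null fun huv => ?_)
  rw [hcs.measure_edge u v huv _ ((measurableSet_toMeasurable _ _).inter measurableSet_Icc)
    inter_subset_right, ENNReal.ofReal_one, one_mul]
  refine measure_mono_null inter_subset_left ?_
  rw [measure_toMeasurable]
  exact ae_iff.1 (h u v huv)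

lemma edgeGrad_edge (hcs : IsCableSystem G (fun _ _ => 1) μ vtx em) (f : X → ℝ) {u v : V}
    (huv : G.Adj u v) {t : ℝ} (ht : t ∈ Ioo (0:ℝ) 1) :
    edgeGrad G em f (em u v t) = |deriv (fun s => f (em u v s)) t| := by
  have h : ∃ q : V × V × ℝ, G.Adj q.1 q.2.1 ∧ q.2.2 ∈ Ioo (0:ℝ) 1 ∧
      em q.1 q.2.1 q.2.2 = em u v t := ⟨(u, v, t), huv, ht, rfl⟩
  rw [edgeGrad, dif_pos h]
  obtain ⟨h1, h2, h3⟩ := h.choose_spec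
  generalize h.choose = q at h1 h2 h3
  obtain ⟨u', v', s⟩ := q
  rcases hcs.interior_disjoint u' v' u v h1 huv s h2 t ht h3 with ⟨rfl, rfl, rfl⟩ | ⟨rfl, rfl, rfl⟩
  · rfl
  · have hflip : (fun r => f (em u' v' r)) = fun r => f (em v' u' (1 - r)) := by
      funext r
      rw [hcs.edge_flip u' v' h1 r]
    simp only [hflip]
    rw [deriv_comp_const_sub (f := fun r => f (em v' u' r)), abs_neg, sub_sub_cancel]

lemma edgeGrad_eq_zero (hcs : IsCableSystem G (fun _ _ => 1) μ vtx em) {f : X → ℝ} {p : X}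
    {c : ℝ} (h : ∀ᶠ q in nhds p, f q = c) : edgeGrad G em f p = 0 := by
  by_cases hp : ∃ q : V × V × ℝ, G.Adj q.1 q.2.1 ∧ q.2.2 ∈ Ioo (0:ℝ) 1 ∧ em q.1 q.2.1 q.2.2 = p
  · obtain ⟨⟨u, v, t⟩, huv, ht, rfl⟩ := hp
    rw [hcs.edgeGrad_edge f huv ht]
    have hc : ContinuousAt (em u v) t :=
      (hcs.continuousOn_edge huv).continuousAt (Icc_mem_nhds ht.1 ht.2)
    have : (fun s => f (em u v s)) =ᶠ[nhds t] fun _ => c := hc.eventually h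
    simp [this.deriv_eq]
  · rw [edgeGrad, dif_neg hp]

/-- A function with an upper gradient is absolutely continuous with a smaller gradient. -/
lemma hasGradMod_edgeGrad (hcs : IsCableSystem G (fun _ _ => 1) μ vtx em) {f k : X → ℝ}
    (h : HasUpperGrad G em f k) : HasGradMod G (fun _ _ => 1) em f (edgeGrad G em f) := by
  refine ⟨h.1, edgeGrad_nonneg G em f, fun u v huv => ⟨deriv fun t => f (em u v t), ?_, ?_, ?_⟩⟩
  · exact (intervalIntegrable_iff_integrableOn_Icc_of_le zero_le_one).1
      (absolutelyContinuousOnInterval_of_abs_sub_le_integral (h.2.2 u v huv).1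
        (h.2.2 u v huv).2).intervalIntegrable_deriv
  · rw [← restrict_Ioo_eq_restrict_Icc]
    refine (ae_restrict_iff' measurableSet_Ioo).2 (Eventually.of_forall fun t ht => ?_)
    exact (hcs.edgeGrad_edge f huv ht).symm
  · intro t ht
    have hac := (absolutelyContinuousOnInterval_of_abs_sub_le_integral (h.2.2 u v huv).1
        (h.2.2 u v huv).2).mono (c := 0) (d := t)
        (uIcc_subset_uIcc (by simp) (by rwa [uIcc_of_le zero_le_one]))
    rw [← intervalIntegral.integral_of_le ht.1, hac.integral_deriv_eq_sub]
    ring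

lemma ae_edgeGrad_le [Countable V] (hcs : IsCableSystem G (fun _ _ => 1) μ vtx em)
    {f k : X → ℝ} (h : HasUpperGrad G em f k) : ∀ᵐ x ∂μ, edgeGrad G em f x ≤ k x := by
  refine hcs.ae_of_ae_edge fun u v huv => ?_
  have h0 : ∀ᵐ t : ℝ, t ≠ 0 := by simp [ae_iff, measure_singleton]
  have h1 : ∀ᵐ t : ℝ, t ≠ 1 := by simp [ae_iff, measure_singleton]
  filter_upwards [ae_abs_deriv_le_of_abs_sub_le_integral (h.2.2 u v huv).1
    (fun t => h.2.1 _) (h.2.2 u v huv).2, h0, h1] with t ht ht0 ht1 htI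
  rw [hcs.edgeGrad_edge f huv ⟨lt_of_le_of_ne htI.1 (Ne.symm ht0), lt_of_le_of_ne htI.2 ht1⟩]
  exact ht htI

/-- The Sobolev embedding: the supremum is bounded by the energy and the `L²`-norm. -/
lemma ofReal_sq_le_of_hasUpperGrad (hcs : IsCableSystem G (fun _ _ => 1) μ vtx em) {f k : X → ℝ}
    (h : HasUpperGrad G em f k) (p : X) :
    ENNReal.ofReal (f p ^ 2) ≤
      2 * ∫⁻ x, ENNReal.ofReal (k x ^ 2) ∂μ + 2 * ∫⁻ x, ENNReal.ofReal (f x ^ 2) ∂μ := by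
  obtain ⟨u, v, s, huv, hs, rfl⟩ := hcs.cover p
  obtain ⟨hint, -⟩ := h.2.2 u v huv
  set a := ∫ x in (0:ℝ)..1, k (em u v x) with ha
  have ha0 : 0 ≤ a := intervalIntegral.integral_nonneg zero_le_one fun x _ => h.2.1 _
  have hvol : (volume : Measure ℝ) (Icc 0 1) = 1 := by simp
  have hjensen : ENNReal.ofReal (a ^ 2) ≤ ∫⁻ t in Icc (0:ℝ) 1, ENNReal.ofReal (k (em u v t) ^ 2) := by
    have hintOn := (intervalIntegrable_iff_integrableOn_Icc_of_le zero_le_one).1 hint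
    have h1 : ENNReal.ofReal (a ^ 2) + ENNReal.ofReal (a ^ 2)
        = ∫⁻ t in Icc (0:ℝ) 1, ENNReal.ofReal (2 * a * k (em u v t)) := by
      rw [← ofReal_integral_eq_lintegral_ofReal (hintOn.const_mul (2 * a))
        (Eventually.of_forall fun t => mul_nonneg (by positivity) (h.2.1 _)),
        integral_const_mul, integral_Icc_eq_integral_Ioc,
        ← intervalIntegral.integral_of_le zero_le_one, ← ha,
        ← ENNReal.ofReal_add (by positivity) (by positivity)]
      congr 1
      ring
    have h2 : ∫⁻ t in Icc (0:ℝ) 1, ENNReal.ofReal (2 * a * k (em u v t)) ≤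
        ENNReal.ofReal (a ^ 2) + ∫⁻ t in Icc (0:ℝ) 1, ENNReal.ofReal (k (em u v t) ^ 2) := by
      calc _ ≤ ∫⁻ t in Icc (0:ℝ) 1,
              (ENNReal.ofReal (a ^ 2) + ENNReal.ofReal (k (em u v t) ^ 2)) := by
            refine lintegral_mono fun t => ?_
            dsimp only
            rw [← ENNReal.ofReal_add (by positivity) (by positivity)]
            exact ENNReal.ofReal_le_ofReal (two_mul_le_add_sq _ _)
        _ = _ := by
            rw [lintegral_add_left measurable_const, setLIntegral_const, hvol, mul_one]
    rw [← h1] at h2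
    exact (ENNReal.add_le_add_iff_left ENNReal.ofReal_ne_top).1 h2
  have hpt : ∀ t ∈ Icc (0:ℝ) 1, ENNReal.ofReal (f (em u v s) ^ 2) ≤
      2 * ENNReal.ofReal (a ^ 2) + 2 * ENNReal.ofReal (f (em u v t) ^ 2) := by
    intro t ht
    have h1 := h.abs_sub_le huv hs ht
    rw [← ha] at h1
    have h2 := sq_le_sq' (by linarith [neg_abs_le (f (em u v s) - f (em u v t))])
      ((le_abs_self _).trans h1)
    rw [← ENNReal.ofReal_ofNat 2, ← ENNReal.ofReal_mul (by norm_num),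
      ← ENNReal.ofReal_mul (by norm_num), ← ENNReal.ofReal_add (by positivity) (by positivity)]
    refine ENNReal.ofReal_le_ofReal ?_
    nlinarith [sq_nonneg (f (em u v s) - 2 * f (em u v t))]
  calc ENNReal.ofReal (f (em u v s) ^ 2)
      = ∫⁻ t in Icc (0:ℝ) 1, ENNReal.ofReal (f (em u v s) ^ 2) := by
        rw [setLIntegral_const, hvol, mul_one]
    _ ≤ ∫⁻ t in Icc (0:ℝ) 1,
          (2 * ENNReal.ofReal (a ^ 2) + 2 * ENNReal.ofReal (f (em u v t) ^ 2)) :=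
        setLIntegral_mono' measurableSet_Icc hpt
    _ = 2 * ENNReal.ofReal (a ^ 2)
          + 2 * ∫⁻ t in Icc (0:ℝ) 1, ENNReal.ofReal (f (em u v t) ^ 2) := by
        rw [lintegral_add_left measurable_const, setLIntegral_const, hvol, mul_one,
          lintegral_const_mul' _ _ (by norm_num)]
    _ ≤ _ := by
        gcongr
        · exact hjensen.trans (hcs.lintegral_edge_le huv fun x => ENNReal.ofReal (k x ^ 2))
        · exact hcs.lintegral_edge_le huv fun x => ENNReal.ofReal (f x ^ 2)

lemma eq_zero_of_memFD (hcs : IsCableSystem G (fun _ _ => 1) μ vtx em) {D : Set X} {f : X → ℝ}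
    (hf : MemFD G (fun _ _ => 1) em μ D f) {p : X} (hp : p ∉ D) : f p = 0 := by
  by_contra hne
  obtain ⟨F, hF, hlim⟩ := hf
  have hpos : 0 < ENNReal.ofReal (f p ^ 2) := ENNReal.ofReal_pos.2 (by positivity)
  have hq : 0 < ENNReal.ofReal (f p ^ 2) / 2 := ENNReal.div_pos hpos.ne' (by norm_num)
  obtain ⟨n, hn⟩ := (hlim.eventually (gt_mem_nhds hq)).exists
  set A := ∫⁻ x, ENNReal.ofReal ((F n x - f x) ^ 2) ∂μ
  have hA : A < ⊤ := (le_add_self.trans_lt hn).trans_le le_top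
  have hlt : dirEnergy G (fun _ _ => 1) em μ (fun x => F n x - f x)
      < ENNReal.ofReal (f p ^ 2) / 2 - A := lt_tsub_iff_right.2 hn
  simp only [dirEnergy, iInf_lt_iff] at hlt
  obtain ⟨g, hg, hlt⟩ := hlt
  have hsup := hcs.ofReal_sq_le_of_hasUpperGrad hg.hasUpperGrad p
  have hFp : F n p = 0 := image_eq_zero_of_notMem_tsupport fun h => hp ((hF n).2.2.1 h)
  rw [hFp, zero_sub, neg_sq, ← mul_add] at hsup
  have := lt_tsub_iff_right.1 hlt
  have h2 := ENNReal.mul_lt_mul_right (a := 2) (by norm_num) (by norm_num) this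
  rw [ENNReal.mul_div_cancel (by norm_num) (by norm_num)] at h2
  exact absurd hsup (not_le.2 h2)

/-- Cutoff functions of bounded energy between concentric balls. -/
lemma exists_cutoff [Countable V] (hcs : IsCableSystem G (fun _ _ => 1) μ vtx em) {C : ℝ}
    {D B : Set X} (hB : IsOpen B)
    (hcap : capacity G (fun _ _ => 1) em μ D B < ENNReal.ofReal C) :
    ∃ ψ g : X → ℝ, HasUpperGrad G em ψ g ∧ (∀ x ∈ B, ψ x = 1) ∧ (∀ x ∉ D, ψ x = 0) ∧
      (∀ x ∈ B, g x = 0) ∧ (∀ x ∉ closure D, g x = 0) ∧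
      ∫⁻ x, ENNReal.ofReal (g x ^ 2) ∂μ ≤ ENNReal.ofReal C := by
  simp only [capacity, iInf_lt_iff] at hcap
  obtain ⟨f, ⟨hfD, U, -, hBU, hU⟩, hlt⟩ := hcap
  simp only [dirEnergy, iInf_lt_iff] at hlt
  obtain ⟨k, hk, hlt⟩ := hlt
  have hug : HasUpperGrad G em (fun x => min (f x) 1) k := by
    obtain ⟨h1, h2, h3⟩ := hk.hasUpperGrad
    refine ⟨h1.min continuous_const, h2, fun u v huv => ⟨(h3 u v huv).1, fun s t hs hst ht => ?_⟩⟩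
    refine le_trans ?_ ((h3 u v huv).2 s t hs hst ht)
    exact abs_inf_sub_inf_le_abs _ _ _
  have h1 : ∀ x ∈ B, min (f x) 1 = 1 := fun x hx => min_eq_right (hU x (hBU hx))
  have h0 : ∀ x ∉ D, min (f x) 1 = 0 := fun x hx => by
    rw [hcs.eq_zero_of_memFD hfD hx]
    norm_num
  refine ⟨_, _, (hcs.hasGradMod_edgeGrad hug).hasUpperGrad, h1, h0, fun x hx => ?_,
    fun x hx => ?_, ?_⟩
  · exact hcs.edgeGrad_eq_zero (c := 1) (by filter_upwards [hB.mem_nhds hx] using h1)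
  · refine hcs.edgeGrad_eq_zero (c := 0) ?_
    filter_upwards [isClosed_closure.isOpen_compl.mem_nhds hx] with q hq
    exact h0 q fun hD => hq (subset_closure hD)
  · refine le_trans (lintegral_mono_ae ?_) hlt.le
    filter_upwards [hcs.ae_edgeGrad_le hug] with x hx
    exact ENNReal.ofReal_le_ofReal (pow_le_pow_left₀ (edgeGrad_nonneg _ _ _ _) hx 2)

/-- In the length metric of a cable system, two points at distance less than `ρ` are joined by a
curve in the ball of radius `ρ`. -/
lemma joinedIn_ball (hcs : IsCableSystem G (fun _ _ => 1) μ vtx em) {p q : X} {ρ : ℝ}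
    (h : dist p q < ρ) : JoinedIn (ball p ρ) p q := by
  set S : X → X → Set ℝ := fun a b =>
    {σ | 0 < σ ∧ (JoinedIn (ball a σ ∩ ball b σ) a b ∨ ρ ≤ σ)} with hS
  have hρ : 0 < ρ := dist_nonneg.trans_lt h
  have hbdd : ∀ a b, BddBelow (S a b) := fun a b => ⟨0, fun σ hσ => hσ.1.le⟩
  have hne : ∀ a b, (S a b).Nonempty := fun a b => ⟨ρ, hρ, Or.inr le_rfl⟩
  have hnn : ∀ a b, 0 ≤ sInf (S a b) := fun a b => le_csInf (hne a b) fun σ hσ => hσ.1.le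
  have hle : sInf (S p q) ≤ dist p q := by
    refine hcs.dist_maximal (fun a b => sInf (S a b)) ?_ ?_ ?_ ?_ p q
    · intro x
      refine le_antisymm (le_of_forall_pos_le_add fun ε hε => ?_) (hnn _ _)
      rw [zero_add]
      exact csInf_le (hbdd _ _) ⟨hε, Or.inl (JoinedIn.refl (by simpa using hε))⟩
    · intro x y
      have : S x y = S y x := by
        ext σ
        simp only [hS, mem_ofPred_eq, inter_comm (ball x σ)]
        exact and_congr_right fun _ => or_congr_left ⟨JoinedIn.symm, JoinedIn.symm⟩
      simp only [this]
    · intro x y z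
      refine le_of_forall_pos_le_add fun ε hε => ?_
      obtain ⟨σ, hσ, hσε⟩ := exists_lt_of_csInf_lt (hne x y)
        (lt_add_of_pos_right (sInf (S x y)) (half_pos hε))
      obtain ⟨τ, hτ, hτε⟩ := exists_lt_of_csInf_lt (hne y z)
        (lt_add_of_pos_right (sInf (S y z)) (half_pos hε))
      refine (csInf_le (hbdd x z) (show σ + τ ∈ S x z from
        ⟨add_pos hσ.1 hτ.1, ?_⟩)).trans (by linarith)
      rcases hσ with ⟨hσ0, hσ | hσ⟩
      swap
      · exact Or.inr (by linarith [hτ.1])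
      rcases hτ with ⟨hτ0, hτ | hτ⟩
      swap
      · exact Or.inr (by linarith)
      left
      have hxy : dist y x < σ := hσ.target_mem.1
      have hyz : dist y z < τ := hτ.source_mem.2
      refine (hσ.mono fun w hw => ?_).trans (hτ.mono fun w hw => ?_)
      · have h1 : dist w x < σ := hw.1
        have h2 : dist w y < σ := hw.2
        exact ⟨by rw [mem_ball]; linarith, by rw [mem_ball]; linarith [dist_triangle w y z]⟩
      · have h1 : dist w y < τ := hw.1
        have h2 : dist w z < τ := hw.2
        exact ⟨by rw [mem_ball]; linarith [dist_triangle w y x], by rw [mem_ball]; linarith⟩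
    · intro u v huv s hs t ht
      refine le_of_forall_pos_le_add fun ε hε => ?_
      refine csInf_le (hbdd _ _) ⟨by positivity, Or.inl ?_⟩
      have hcont := (hcs.continuousOn_edge huv).mono (uIcc_subset_Icc hs ht)
      have hpc : IsPathConnected (uIcc s t) := by
        rw [← segment_eq_uIcc]
        exact (convex_segment s t).isPathConnected ⟨s, left_mem_segment ℝ s t⟩
      refine ((hpc.image' hcont).joinedIn _ (mem_image_of_mem _ left_mem_uIcc) _
        (mem_image_of_mem _ right_mem_uIcc)).mono ?_
      rintro _ ⟨r, hr, rfl⟩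
      have hrI : r ∈ Icc (0:ℝ) 1 := uIcc_subset_Icc hs ht hr
      constructor
      · refine (hcs.edge_lip u v huv r hrI s hs).trans_lt ?_
        linarith [abs_sub_left_of_mem_uIcc hr, abs_sub_comm s t]
      · refine (hcs.edge_lip u v huv r hrI t ht).trans_lt ?_
        linarith [abs_sub_right_of_mem_uIcc hr, abs_sub_comm s t, abs_sub_comm r t]
  obtain ⟨σ, hσ, hlt⟩ := exists_lt_of_csInf_lt (hne p q) (hle.trans_lt h)
  rcases hσ.2 with hj | hj
  · exact hj.mono (inter_subset_left.trans (ball_subset_ball hlt.le))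
  · exact absurd hlt (not_lt.2 hj)

/-- Truncating a function to a path component of the set where it does not vanish preserves its
upper gradients. -/
lemma hasUpperGrad_indicator (hcs : IsCableSystem G (fun _ _ => 1) μ vtx em) {η k : X → ℝ}
    (h : HasUpperGrad G em η k) (y : X) :
    HasUpperGrad G em ({p | JoinedIn {q | η q ≠ 0} y p}.indicator η) k := by
  classical
  set A := {q | η q ≠ 0} with hA
  set U := {p | JoinedIn A y p} with hU
  have hAo : IsOpen A := isOpen_ne_fun h.1 continuous_const
  have habs : ∀ p, |U.indicator η p| ≤ |η p| := fun p => norm_indicator_le_norm_self η p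
  have hsame : ∀ p q, JoinedIn A p q → (p ∈ U ↔ q ∈ U) := fun p q hpq =>
    ⟨fun hp => JoinedIn.trans hp hpq, fun hq => JoinedIn.trans hq hpq.symm⟩
  refine ⟨continuous_iff_continuousAt.2 fun p => ?_, h.2.1, fun u v huv =>
    ⟨(h.2.2 u v huv).1, fun s t hs hst ht => ?_⟩⟩
  · by_cases hp : η p = 0
    · have h0 : U.indicator η p = 0 := by
        have := habs p
        rw [hp, abs_zero] at this
        exact abs_nonpos_iff.1 this
      rw [ContinuousAt, h0]
      refine squeeze_zero_norm habs ?_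
      have := h.1.abs.tendsto p
      simpa only [hp, abs_zero] using this
    · obtain ⟨ε, hε, hball⟩ := Metric.isOpen_iff.1 hAo p hp
      have hj : ∀ q ∈ ball p ε, (p ∈ U ↔ q ∈ U) := fun q hq =>
        hsame p q ((hcs.joinedIn_ball (by rwa [dist_comm])).mono hball)
      by_cases hpU : p ∈ U
      · refine h.1.continuousAt.congr ?_
        filter_upwards [ball_mem_nhds p hε] with q hq
        rw [indicator_of_mem ((hj q hq).1 hpU)]
      · refine (continuousAt_const (y := (0:ℝ))).congr ?_
        filter_upwards [ball_mem_nhds p hε] with q hq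
        rw [indicator_of_notMem fun hqU => hpU ((hj q hq).2 hqU)]
  · obtain ⟨hint, hle⟩ := h.2.2 u v huv
    by_cases hz : ∃ c ∈ Icc s t, η (em u v c) = 0
    · obtain ⟨c, hc, hc0⟩ := hz
      have h1 := hle s c hs hc.1 (hc.2.trans ht)
      have h2 := hle c t (hs.trans hc.1) hc.2 ht
      rw [hc0, zero_sub, abs_neg] at h1
      rw [hc0, sub_zero] at h2
      have hsub : ∀ a b, 0 ≤ a → a ≤ b → b ≤ 1 →
          IntervalIntegrable (fun x => k (em u v x)) volume a b := fun a b ha hab hb =>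
        hint.mono_set (by
          rw [uIcc_of_le hab, uIcc_of_le zero_le_one]
          exact Icc_subset_Icc ha hb)
      rw [← intervalIntegral.integral_add_adjacent_intervals (hsub s c hs hc.1 (hc.2.trans ht))
        (hsub c t (hs.trans hc.1) hc.2 ht)]
      have := abs_sub (U.indicator η (em u v t)) (U.indicator η (em u v s))
      linarith [habs (em u v t), habs (em u v s)]
    · push Not at hz
      have hj : JoinedIn A (em u v s) (em u v t) := by
        have hcont := (hcs.continuousOn_edge huv).mono (Icc_subset_Icc hs ht)
        have hpc : IsPathConnected (Icc s t) :=
          (convex_Icc s t).isPathConnected ⟨s, left_mem_Icc.2 hst⟩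
        refine ((hpc.image' hcont).joinedIn _ (mem_image_of_mem _ (left_mem_Icc.2 hst)) _
          (mem_image_of_mem _ (right_mem_Icc.2 hst))).mono ?_
        rintro _ ⟨r, hr, rfl⟩
        exact hz r hr
      by_cases hsU : em u v s ∈ U
      · rw [indicator_of_mem hsU, indicator_of_mem ((hsame _ _ hj).1 hsU)]
        exact hle s t hs hst ht
      · rw [indicator_of_notMem hsU, indicator_of_notMem fun h => hsU ((hsame _ _ hj).2 h),
          sub_zero, abs_zero]
        exact intervalIntegral.integral_nonneg hst fun x _ => h.2.1 _

lemma edge_one (hcs : IsCableSystem G (fun _ _ => 1) μ vtx em) {u v : V} (huv : G.Adj u v) :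
    em u v 1 = vtx v := by
  rw [hcs.edge_flip u v huv 1, sub_self, hcs.edge_start v u huv.symm]

lemma dist_vtx_le (hcs : IsCableSystem G (fun _ _ => 1) μ vtx em) {u v : V} (w : G.Walk u v) :
    dist (vtx u) (vtx v) ≤ w.length := by
  induction w with
  | nil => simp
  | @cons a b c hab w ih =>
    have h1 := hcs.edge_lip a b hab 0 (by simp) 1 (by simp)
    rw [hcs.edge_start a b hab, hcs.edge_one hab] at h1
    have h2 : dist (vtx a) (vtx b) ≤ 1 := by simpa using h1
    rw [SimpleGraph.Walk.length_cons]
    push_cast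
    linarith [dist_triangle (vtx a) (vtx b) (vtx c)]

/-- Balls of the cable system are at least as large as the balls of the graph. -/
lemma volume_lower_bound (hcs : IsCableSystem G (fun _ _ => 1) μ vtx em) (hconn : G.Connected)
    {d : ℝ} (hd : 0 ≤ d) (hpoly : HasPolynomialGrowth G d) :
    ∃ c : ℝ, 0 < c ∧ ∀ (p : X) (r : ℝ), 4 ≤ r → ENNReal.ofReal (c * r ^ d) ≤ μ (ball p r) := by
  obtain ⟨C, hC, hvol⟩ := hpoly
  have hC0 : 0 < C⁻¹ := by positivity
  refine ⟨2⁻¹ * C⁻¹ * (2⁻¹) ^ d, by positivity, fun p r hr => ?_⟩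
  obtain ⟨u, v, s, huv, hs, rfl⟩ := hcs.cover p
  have hnt : Nontrivial V := ⟨u, v, huv.ne⟩
  have hnbr : ∀ w, ∃ w', G.Adj w w' := fun w => hconn.preconnected.exists_adj_of_nontrivial w
  choose N hN using hnbr
  have hcard := (hvol u (r - 2) (by linarith)).1
  set S := {y : V | (G.dist u y : ℝ) < r - 2} with hS
  have hSfin : Finite S := by
    refine Nat.finite_of_card_ne_zero fun h => ?_
    rw [h, Nat.cast_zero] at hcard
    have : 0 < C⁻¹ * (r - 2) ^ d := mul_pos hC0 (Real.rpow_pos_of_pos (by linarith) d)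
    linarith
  have hSf : S.Finite := hSfin
  have hsubI : Ioo (0:ℝ) (1/2) ⊆ Icc 0 1 := fun t ht => ⟨ht.1.le, by linarith [ht.2]⟩
  have hmeas : ∀ w, μ (em w (N w) '' Ioo 0 (1/2)) = ENNReal.ofReal 2⁻¹ := by
    intro w
    rw [hcs.measure_edge w (N w) (hN w) _ measurableSet_Ioo hsubI, Real.volume_Ioo,
      ENNReal.ofReal_one, one_mul]
    norm_num
  have hmset : ∀ w, MeasurableSet (em w (N w) '' Ioo 0 (1/2)) := by
    intro w
    have : em w (N w) '' Ioo 0 (1/2) = (fun t : Icc (0:ℝ) 1 => em w (N w) t) ''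
        (Subtype.val ⁻¹' Ioo 0 (1/2)) := by
      rw [← Function.comp_def (em w (N w)) Subtype.val, image_comp, Subtype.image_preimage_coe,
        inter_eq_right.2 hsubI]
    rw [this]
    exact (hcs.measurableEmbedding_edge (hN w)).measurableSet_image.2
      (measurable_subtype_coe measurableSet_Ioo)
  have hdisj : ∀ w w', w ≠ w' → Disjoint (em w (N w) '' Ioo 0 (1/2))
      (em w' (N w') '' Ioo 0 (1/2)) := by
    intro w w' hne
    rw [Set.disjoint_left]
    rintro _ ⟨a, ha, rfl⟩ ⟨b, hb, hab⟩
    rcases hcs.interior_disjoint w' (N w') w (N w) (hN w') (hN w) b ⟨hb.1, by linarith [hb.2]⟩ a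
      ⟨ha.1, by linarith [ha.2]⟩ hab with h | h
    · exact hne h.1.symm
    · linarith [h.2.2, ha.2, hb.2]
  have hsub : ⋃ w ∈ hSf.toFinset, em w (N w) '' Ioo 0 (1/2) ⊆ ball (em u v s) r := by
    simp only [iUnion_subset_iff, hSf.mem_toFinset]
    rintro w hw _ ⟨t, ht, rfl⟩
    obtain ⟨W, hW⟩ := hconn.exists_walk_length_eq_dist u w
    have h1 := hcs.dist_vtx_le W
    rw [hW] at h1
    have h2 := hcs.edge_lip u v huv 0 (by simp) s hs
    have h3 := hcs.edge_lip w (N w) (hN w) t (hsubI ht) 0 (by simp)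
    rw [hcs.edge_start u v huv, zero_sub, abs_neg, abs_of_nonneg hs.1] at h2
    rw [hcs.edge_start w _ (hN w), sub_zero, abs_of_nonneg ht.1.le] at h3
    have h4 : (G.dist u w : ℝ) < r - 2 := hw
    have h5 := dist_triangle4 (em w (N w) t) (vtx w) (vtx u) (em u v s)
    rw [dist_comm (vtx w)] at h5
    rw [mem_ball]
    linarith [hs.2, ht.2]
  calc ENNReal.ofReal (2⁻¹ * C⁻¹ * 2⁻¹ ^ d * r ^ d)
      ≤ ENNReal.ofReal (2⁻¹ * (hSf.toFinset.card : ℝ)) := by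
        refine ENNReal.ofReal_le_ofReal ?_
        have hpow : (2⁻¹ : ℝ) ^ d * r ^ d ≤ (r - 2) ^ d := by
          rw [← Real.mul_rpow (by norm_num) (by linarith)]
          exact Real.rpow_le_rpow (by linarith) (by linarith) hd
        have : (Nat.card S : ℝ) = hSf.toFinset.card := by
          rw [Nat.card_coe_set_eq, Set.ncard_eq_toFinset_card S hSf]
        rw [← this]
        have h6 := mul_le_mul_of_nonneg_left hpow hC0.le
        nlinarith
    _ = ∑ w ∈ hSf.toFinset, μ (em w (N w) '' Ioo 0 (1/2)) := by
        rw [Finset.sum_congr rfl fun w _ => hmeas w, Finset.sum_const, nsmul_eq_mul,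
          ENNReal.ofReal_mul (by norm_num), ENNReal.ofReal_natCast, mul_comm]
    _ = μ (⋃ w ∈ hSf.toFinset, em w (N w) '' Ioo 0 (1/2)) :=
        (measure_biUnion_finset (fun w _ w' _ hne => hdisj w w' hne) fun w _ => hmset w).symm
    _ ≤ μ (ball (em u v s) r) := measure_mono hsub

end IsCableSystem

lemma HasPolynomialGrowth.countable {G : SimpleGraph V} {d : ℝ} (h : HasPolynomialGrowth G d) :
    Countable V := by
  obtain ⟨C, hC, hvol⟩ := h
  rcases isEmpty_or_nonempty V with hV | ⟨⟨x⟩⟩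
  · infer_instance
  have hfin : ∀ n : ℕ, {y : V | (G.dist x y : ℝ) < n + 1}.Finite := by
    intro n
    have hn : (1:ℝ) ≤ n + 1 := by linarith [n.cast_nonneg (α := ℝ)]
    refine Nat.finite_of_card_ne_zero fun h => ?_
    have := (hvol x (n + 1) hn).1
    rw [h, Nat.cast_zero] at this
    have : 0 < C⁻¹ * ((n:ℝ) + 1) ^ d := by positivity
    linarith
  refine Set.countable_univ_iff.1 ((countable_iUnion fun n => (hfin n).countable).mono ?_)
  intro y _
  exact mem_iUnion.2 ⟨G.dist x y, by simp⟩

lemma HasUpperGrad.const_mul_sum [TopologicalSpace X] {G : SimpleGraph V} {em : V → V → ℝ → X}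
    {ι : Type*} {s : Finset ι} {f k : ι → X → ℝ} (h : ∀ i ∈ s, HasUpperGrad G em (f i) (k i))
    {ε : ι → ℝ} (hε : ∀ i ∈ s, |ε i| ≤ 1) {a : ℝ} (ha : 0 ≤ a) :
    HasUpperGrad G em (fun x => a * ∑ i ∈ s, ε i * f i x) (fun x => a * ∑ i ∈ s, k i x) := by
  refine ⟨continuous_const.mul (continuous_finsetSum _ fun i hi =>
    continuous_const.mul (h i hi).1), fun x => mul_nonneg ha (Finset.sum_nonneg fun i hi =>
    (h i hi).2.1 x), fun u v huv => ⟨?_, fun b c hb hbc hc => ?_⟩⟩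
  · refine IntervalIntegrable.const_mul ?_ a
    have := IntervalIntegrable.sum s (fun i hi => ((h i hi).2.2 u v huv).1)
    refine this.congr ?_
    intro x _
    simp
  · rw [intervalIntegral.integral_const_mul, intervalIntegral.integral_finsetSum, ← mul_sub,
      abs_mul, abs_of_nonneg ha, ← Finset.sum_sub_distrib]
    · refine mul_le_mul_of_nonneg_left ((Finset.abs_sum_le_sum_abs _ _).trans
        (Finset.sum_le_sum fun i hi => ?_)) ha
      rw [← mul_sub, abs_mul]
      exact (mul_le_of_le_one_left (abs_nonneg _) (hε i hi)).trans
        (((h i hi).2.2 u v huv).2 b c hb hbc hc)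
    · intro i hi
      refine ((h i hi).2.2 u v huv).1.mono_set ?_
      rw [uIcc_of_le hbc, uIcc_of_le zero_le_one]
      exact Icc_subset_Icc hb hc

/-- Functions vanishing off disjoint sets are orthogonal (no measurability is needed). -/
lemma lintegral_sq_sum_le_of_disjoint [MeasurableSpace X] {μ : Measure X} {ι : Type*}
    (s : Finset ι) {A : ι → Set X} (hA : ∀ i, MeasurableSet (A i))
    (hdisj : ∀ i j, i ≠ j → Disjoint (A i) (A j)) {g : ι → X → ℝ}
    (hg : ∀ i, ∀ x ∉ A i, g i x = 0) :
    ∫⁻ x, ENNReal.ofReal ((∑ i ∈ s, g i x) ^ 2) ∂μ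
      ≤ ∑ i ∈ s, ∫⁻ x, ENNReal.ofReal (g i x ^ 2) ∂μ := by
  classical
  induction s using Finset.induction_on with
  | empty => simp
  | insert a s ha ih =>
    rw [Finset.sum_insert ha, ← lintegral_add_compl _ (hA a)]
    refine add_le_add ?_ ((le_trans ?_ (setLIntegral_le_lintegral (A a)ᶜ _)).trans ih)
    · refine le_trans (le_of_eq (setLIntegral_congr_fun (hA a) fun x hx => ?_))
        (setLIntegral_le_lintegral (A a) _)
      rw [Finset.sum_insert ha, Finset.sum_eq_zero fun i hi => hg i x fun hxi =>
        Set.disjoint_left.1 (hdisj i a fun h => ha (h ▸ hi)) hxi hx, add_zero]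
    · refine le_of_eq (setLIntegral_congr_fun (hA a).compl fun x hx => ?_)
      rw [Finset.sum_insert ha, hg a x hx, zero_add]

/-- Averaging capacitary cutoffs over many scales produces a function of small energy which is
equal to one on an annulus, and to zero well inside and well outside of it. -/
lemma IsCableSystem.exists_annular_cutoff [MetricSpace X] [MeasurableSpace X] [Countable V]
    {G : SimpleGraph V} {μ : Measure X} {vtx : V → X} {em : V → V → ℝ → X}
    (hcs : IsCableSystem G (fun _ _ => 1) μ vtx em) {C M : ℝ} (hM : 1 ≤ M)
    (hcap : ∀ (x : X) (r : ℝ), 1 ≤ r → capacity G (fun _ _ => 1) em μ (ball x (M * r)) (ball x r)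
      < ENNReal.ofReal C) (x : X) {ρ : ℝ} (hρ : 1 ≤ ρ) (m : ℕ) :
    ∃ η k : X → ℝ, HasUpperGrad G em η k ∧
      (∀ p, dist p x < ρ → η p = 0) ∧
      (∀ p, ρ * (8 * M) ^ (m + 1 + (m + 1)) ≤ dist p x → η p = 0) ∧
      (∀ p, M * (ρ * (8 * M) ^ m) ≤ dist p x → dist p x < ρ * (8 * M) ^ (m + 1) → η p = 1) ∧
      ∫⁻ p, ENNReal.ofReal (k p ^ 2) ∂μ ≤ ENNReal.ofReal (2 * C / (m + 1)) := by
  have := hcs.isBorel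
  have hL : 1 ≤ 8 * M := by linarith
  have hρpos : ∀ i, 0 < ρ * (8 * M) ^ i := fun i => by positivity
  have hmono : ∀ i j, i ≤ j → ρ * (8 * M) ^ i ≤ ρ * (8 * M) ^ j := fun i j hij =>
    mul_le_mul_of_nonneg_left (pow_le_pow_right₀ hL hij) (by linarith)
  have hlt : ∀ i j, i < j → M * (ρ * (8 * M) ^ i) < ρ * (8 * M) ^ j := fun i j hij => by
    refine lt_of_lt_of_le ?_ (hmono (i + 1) j hij)
    have := hρpos i
    rw [pow_succ]
    nlinarith [mul_pos (by linarith : (0:ℝ) < M) this]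
  choose ψ g hug hψ1 hψ0 hg0 hg1 hE using fun i : ℕ =>
    hcs.exists_cutoff (D := ball x (M * (ρ * (8 * M) ^ i))) (B := ball x (ρ * (8 * M) ^ i))
      isOpen_ball (hcap x (ρ * (8 * M) ^ i)
        (hρ.trans (le_mul_of_one_le_right (by linarith) (one_le_pow₀ hL))))
  have hn : (0:ℝ) < (m:ℝ) + 1 := by positivity
  have hsplit : ∀ p, ∑ i ∈ Finset.range (m + 1 + (m + 1)), (if i < m + 1 then (-1:ℝ) else 1) * ψ i p
      = -(∑ i ∈ Finset.range (m + 1), ψ i p) + ∑ i ∈ Finset.range (m + 1), ψ (m + 1 + i) p := by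
    intro p
    rw [Finset.sum_range_add, ← Finset.sum_neg_distrib]
    congr 1
    · refine Finset.sum_congr rfl fun i hi => ?_
      rw [if_pos (Finset.mem_range.1 hi), neg_one_mul]
    · refine Finset.sum_congr rfl fun i hi => ?_
      rw [if_neg (by omega), one_mul]
  refine ⟨_, _, HasUpperGrad.const_mul_sum (s := Finset.range (m + 1 + (m + 1)))
    (ε := fun i => if i < m + 1 then (-1:ℝ) else 1) (fun i _ => hug i)
    (fun i _ => by split_ifs <;> simp) (inv_nonneg.2 hn.le), ?_, ?_, ?_, ?_⟩
  · intro p hp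
    have h1 : ∀ i, ψ i p = 1 := fun i => hψ1 i p (by
      have := hmono 0 i (Nat.zero_le i)
      rw [pow_zero, mul_one] at this
      exact hp.trans_le this)
    simp only [hsplit]
    simp only [h1]
    simp
  · intro p hp
    have h0 : ∀ i ∈ Finset.range (m + 1 + (m + 1)), ψ i p = 0 := fun i hi => hψ0 i p fun h =>
      absurd (mem_ball.1 h) (not_lt.2 ((hlt i _ (Finset.mem_range.1 hi)).le.trans hp))
    rw [Finset.sum_eq_zero fun i hi => by rw [h0 i hi, mul_zero], mul_zero]
  · intro p hp1 hp2
    have h0 : ∀ i ∈ Finset.range (m + 1), ψ i p = 0 := fun i hi => hψ0 i p fun h =>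
      absurd (mem_ball.1 h) (not_lt.2 (le_trans (mul_le_mul_of_nonneg_left
        (hmono i m (by have := Finset.mem_range.1 hi; omega)) (by linarith)) hp1))
    have h1 : ∀ i ∈ Finset.range (m + 1), ψ (m + 1 + i) p = 1 := fun i _ => hψ1 _ p
      (hp2.trans_le (hmono _ _ (by omega)))
    simp only [hsplit]
    rw [Finset.sum_eq_zero h0, Finset.sum_congr rfl h1]
    simp only [Finset.sum_const, Finset.card_range, nsmul_eq_mul, mul_one, neg_zero, zero_add]
    push_cast
    exact inv_mul_cancel₀ hn.ne'
  · set A : ℕ → Set X := fun i =>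
      closedBall x (M * (ρ * (8 * M) ^ i)) \ ball x (ρ * (8 * M) ^ i) with hA
    have hdisj' : ∀ i j, i < j → Disjoint (A i) (A j) := fun i j hij =>
      Set.disjoint_left.2 fun p hpi hpj => hpj.2 (lt_of_le_of_lt hpi.1 (hlt i j hij))
    have hsum := lintegral_sq_sum_le_of_disjoint (μ := μ) (Finset.range (m + 1 + (m + 1)))
      (A := A) (fun i => measurableSet_closedBall.diff measurableSet_ball)
      (fun i j hij => (lt_or_gt_of_ne hij).elim (hdisj' i j) fun h => (hdisj' j i h).symm)
      (g := g) (fun i p hp => by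
        by_cases hb : p ∈ ball x (ρ * (8 * M) ^ i)
        · exact hg0 i p hb
        · exact hg1 i p fun hc => hp ⟨closure_ball_subset_closedBall hc, hb⟩)
    calc ∫⁻ p, ENNReal.ofReal (((m + 1 : ℝ)⁻¹ *
          ∑ i ∈ Finset.range (m + 1 + (m + 1)), g i p) ^ 2) ∂μ
        = ENNReal.ofReal ((m + 1 : ℝ)⁻¹ ^ 2) * ∫⁻ p, ENNReal.ofReal
          ((∑ i ∈ Finset.range (m + 1 + (m + 1)), g i p) ^ 2) ∂μ := by
          rw [← lintegral_const_mul' _ _ ENNReal.ofReal_ne_top]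
          refine lintegral_congr fun p => ?_
          rw [mul_pow, ENNReal.ofReal_mul (by positivity)]
      _ ≤ ENNReal.ofReal ((m + 1 : ℝ)⁻¹ ^ 2) *
          ∑ i ∈ Finset.range (m + 1 + (m + 1)), ENNReal.ofReal C := by
          gcongr
          exact hsum.trans (Finset.sum_le_sum fun i _ => hE i)
      _ = ENNReal.ofReal (2 * C / (m + 1)) := by
          rw [Finset.sum_const, Finset.card_range, ← ENNReal.ofReal_nsmul,
            ← ENNReal.ofReal_mul (by positivity), nsmul_eq_mul]
          congr 1
          push_cast
          field_simp
          ring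

/-- A function equal to one on one ball and to zero on another one is, in mean square, far from
any constant. -/
lemma le_lintegral_sq_sub_of_eq_one_of_eq_zero [MetricSpace X] [MeasurableSpace X]
    [BorelSpace X] {μ : Measure X} {F : X → ℝ} {y z : X} {s a b : ℝ} {B : Set X}
    (hyB : ball y s ⊆ B) (hzB : ball z s ⊆ B) (hy : ∀ p ∈ ball y s, F p = 1)
    (hz : ∀ p ∈ ball z s, F p = 0) (hμy : ENNReal.ofReal b ≤ μ (ball y s))
    (hμz : ENNReal.ofReal b ≤ μ (ball z s)) :
    ENNReal.ofReal (4⁻¹ * b) ≤ ∫⁻ p in B, ENNReal.ofReal ((F p - a) ^ 2) ∂μ := by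
  have key : ∀ (t : ℝ) (c : X), (∀ p ∈ ball c s, F p = t) → ball c s ⊆ B →
      ENNReal.ofReal b ≤ μ (ball c s) → 4⁻¹ ≤ (t - a) ^ 2 →
      ENNReal.ofReal (4⁻¹ * b) ≤ ∫⁻ p in B, ENNReal.ofReal ((F p - a) ^ 2) ∂μ := by
    intro t c hF hcB hμ ht
    calc ENNReal.ofReal (4⁻¹ * b) = ENNReal.ofReal 4⁻¹ * ENNReal.ofReal b :=
          ENNReal.ofReal_mul (by norm_num)
      _ ≤ ENNReal.ofReal ((t - a) ^ 2) * μ (ball c s) := by gcongr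
      _ = ∫⁻ p in ball c s, ENNReal.ofReal ((F p - a) ^ 2) ∂μ := by
          rw [← setLIntegral_const]
          exact setLIntegral_congr_fun measurableSet_ball fun p hp => by rw [hF p hp]
      _ ≤ _ := lintegral_mono_set hcB
  rcases le_total a 2⁻¹ with h | h
  · exact key 1 y hy hyB hμy (by nlinarith)
  · exact key 0 z hz hzB hμz (by nlinarith)

/-- **Proposition (annular quasi-convexity at large scales).**  Let `G` be a connected,
locally finite, simple graph of polynomial growth with volume growth exponent `d ≥ 2`, and
let `(X, d₁, μ₁)` be its cable system with unit length function `ℓ ≡ 1`.  If the cable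
system satisfies the capacity upper bound `(cap_≤)` and the Poincaré inequality `PI(Ψ)`
with `Ψ(r) = r² ∨ r^d`, then `(X, d₁)` is annular quasi-convex at large scales. -/
theorem annular_quasiconvexity_of_capLE_and_PI
    {V X : Type*} [MetricSpace X] [MeasurableSpace X] [CompleteSpace X]
    (G : SimpleGraph V) (hconn : G.Connected) (hlf : ∀ v : V, (G.neighborSet v).Finite)
    (d : ℝ) (hd : 2 ≤ d) (hpoly : HasPolynomialGrowth G d)
    (μ : Measure X) (vtx : V → X) (em : V → V → ℝ → X)
    (hcs : IsCableSystem G (fun _ _ => 1) μ vtx em)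
    (hcap : CapLE G (fun _ _ => 1) em μ)
    (hPI : PoincareIneq G (fun _ _ => 1) em μ (fun r => max (r ^ 2) (r ^ d))) :
    AnnularQCLargeScales X := by
  have := hcs.isBorel
  have : Countable V := hpoly.countable
  by_cases hdiam : Metric.ediam (univ : Set X) = ⊤
  swap
  · refine ⟨(Metric.ediam (univ : Set X)).toReal + 1, 1, by positivity, one_pos,
      fun x r hr y hy => absurd ?_ hy.2⟩
    have : dist y x ≤ (Metric.ediam (univ : Set X)).toReal :=
      dist_le_diam_of_mem' hdiam (mem_univ y) (mem_univ x)
    rw [mem_ball]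
    linarith
  obtain ⟨C₀, M, hC₀, hM, hcap⟩ := hcap
  obtain ⟨C, M', hC, hM', hPI⟩ := hPI
  obtain ⟨c, hc, hvol⟩ := hcs.volume_lower_bound hconn (by linarith) hpoly
  have hcap' : ∀ (x : X) (r : ℝ), 1 ≤ r →
      capacity G (fun _ _ => 1) em μ (ball x (M * r)) (ball x r) < ENNReal.ofReal (C₀ + 1) :=
    fun x r hr => (hcap x r hr).trans_lt
      ((ENNReal.ofReal_lt_ofReal_iff (by linarith)).2 (by linarith))
  obtain ⟨m, hm⟩ := exists_nat_gt (8 * C * (C₀ + 1) * 8 ^ d / c)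
  have hL : 1 ≤ 8 * M := by linarith
  have hLm : 1 ≤ (8 * M) ^ m := one_le_pow₀ hL
  have hR : 8 ≤ 8 * M * (8 * M) ^ m := by nlinarith
  refine ⟨8 * M * (8 * M) ^ m, 4 * (8 * M) ^ (m + 1), by positivity, by positivity,
    fun x r hr y hy z hz => ?_⟩
  have hr8 : 8 ≤ r := hR.trans hr
  set ρ := r / (2 * M * (8 * M) ^ m) with hρ
  have hρr : 2 * M * (8 * M) ^ m * ρ = r := by rw [hρ]; field_simp
  have hρ1 : 1 ≤ ρ := by
    rw [hρ, one_le_div (by positivity)]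
    nlinarith [mul_pos (by linarith : 0 < M) (by linarith : 0 < (8 * M) ^ m)]
  obtain ⟨η, k, hk, hη0, hηtop, hη1, hkE⟩ :=
    hcs.exists_annular_cutoff hM hcap' x hρ1 m
  have hηr : ∀ p, r / 2 ≤ dist p x → dist p x < 4 * r → η p = 1 := by
    intro p h1 h2
    refine hη1 p (le_of_eq_of_le ?_ h1) (lt_of_lt_of_eq h2 ?_)
    · rw [← hρr]; ring
    · rw [← hρr]; ring
  by_cases hj : JoinedIn {q | η q ≠ 0} y z
  · refine ⟨0, 1, hj.somePath.extend, zero_le_one, hj.somePath.continuous_extend.continuousOn,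
      hj.somePath.extend_zero, hj.somePath.extend_one, fun t ht => ?_⟩
    have hmem : η (hj.somePath.extend t) ≠ 0 := by
      rw [hj.somePath.extend_apply ht]
      exact hj.somePath_mem ⟨t, ht⟩
    refine ⟨?_, fun h => hmem (hη0 _ (lt_of_lt_of_le h ?_))⟩
    · by_contra h
      refine hmem (hηtop _ (le_trans (le_of_eq ?_) (not_lt.1 h)))
      rw [← hρr]; ring
    · rw [hρ]
      refine div_le_div_of_nonneg_left (by linarith) (by positivity) ?_
      rw [pow_succ]
      nlinarith [mul_pos (by linarith : 0 < M) (by linarith : 0 < (8 * M) ^ m)]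
  exfalso
  have hnear : ∀ w ∈ ball x (2 * r) \ ball x r, ∀ p ∈ ball w (r / 2),
      η p = 1 ∧ p ∈ ball x (4 * r) := by
    intro w hw p hp
    have h1 := mem_ball.1 hw.1
    have h2 : r ≤ dist w x := not_lt.1 hw.2
    have h3 := mem_ball.1 hp
    have h4 := dist_triangle p w x
    have h5 := dist_triangle_left w x p
    have h6 : dist p x < 4 * r := by linarith
    exact ⟨hηr p (by linarith) h6, h6⟩
  have hjoin : ∀ w ∈ ball x (2 * r) \ ball x r, ∀ p ∈ ball w (r / 2),
      JoinedIn {q | η q ≠ 0} w p := fun w hw p hp =>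
    (hcs.joinedIn_ball (mem_ball'.1 hp)).mono fun q hq => by
      exact ne_of_eq_of_ne (hnear w hw q hq).1 one_ne_zero
  have hF := hcs.hasUpperGrad_indicator hk y
  set F := {p | JoinedIn {q | η q ≠ 0} y p}.indicator η with hFdef
  have hFE : ∫⁻ p, ENNReal.ofReal (edgeGrad G em F p ^ 2) ∂μ
      ≤ ENNReal.ofReal (2 * (C₀ + 1) / (m + 1)) := by
    refine le_trans (lintegral_mono_ae ?_) hkE
    filter_upwards [hcs.ae_edgeGrad_le hF] with p hp
    exact ENNReal.ofReal_le_ofReal (pow_le_pow_left₀ (edgeGrad_nonneg _ _ _ _) hp 2)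
  have hlow := le_lintegral_sq_sub_of_eq_one_of_eq_zero (F := F)
    (a := ⨍ p in ball x (4 * r), F p ∂μ)
    (fun p hp => (hnear y hy p hp).2) (fun p hp => (hnear z hz p hp).2)
    (fun p hp => by
      rw [hFdef, indicator_of_mem (show p ∈ {p | JoinedIn {q | η q ≠ 0} y p} from hjoin y hy p hp),
        (hnear y hy p hp).1])
    (fun p hp => indicator_of_notMem (s := {p | JoinedIn {q | η q ≠ 0} y p})
      (fun h => hj (JoinedIn.trans h (hjoin z hz p hp).symm)) η)
    (hvol y (r / 2) (by linarith)) (hvol z (r / 2) (by linarith))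
  have hup := hPI F _ (hcs.hasGradMod_edgeGrad hF) (hFE.trans_lt ENNReal.ofReal_lt_top) x (4 * r)
    (by linarith) (lt_of_lt_of_eq ENNReal.ofReal_lt_top hdiam.symm)
  have hmax : max ((4 * r) ^ 2) ((4 * r) ^ d) = (4 * r) ^ d := by
    rw [max_eq_right_iff, ← Real.rpow_natCast]
    exact Real.rpow_le_rpow_of_exponent_le (by linarith) (by exact_mod_cast hd)
  have hfinal := hlow.trans (hup.trans (mul_le_mul_right
    ((setLIntegral_le_lintegral _ _).trans hFE) _))
  simp only [hmax] at hfinal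
  rw [← ENNReal.ofReal_mul (by positivity), ENNReal.ofReal_le_ofReal_iff (by positivity)]
    at hfinal
  have hpow : (4 * r) ^ d = 8 ^ d * (r / 2) ^ d := by
    rw [← Real.mul_rpow (by norm_num) (by linarith)]
    congr 1
    ring
  have hs : 0 < (r / 2) ^ d := by positivity
  rw [hpow] at hfinal
  rw [div_lt_iff₀ hc] at hm
  have hkey : 4⁻¹ * c ≤ C * 8 ^ d * (2 * (C₀ + 1) / (m + 1)) :=
    le_of_mul_le_mul_right (by linarith) hs
  rw [← mul_div_assoc, le_div_iff₀ (by positivity)] at hkey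
  nlinarith

end
end
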